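/- arXiv:0807.0688 — 2 statements merged into one kernel-verified Lean document; each statement's English description precedes it below -/
import Mathlib

section
/- For all integers k ≥ 1, t ≥ 2 with k + t ≥ 4 and c ∈ {0,1}, the bilinear form ⟨x,y⟩ := ψ(xy) on B^{k,t}_c is associative (⟨xy,z⟩ = ⟨x,yz⟩ for all x,y,z), symmetric, and non-degenerate. In particular B^{k,t}_c is a symmetric F-algebra. -/
/- Common setup: the algebras B^{k,t}_c = SD(2B)₂^{k,t}(c) of semidihedral type,
   over a field F, presented as a quotient of the free algebra on the paths-generators
   e₁, e₂ (trivial paths), α (loop at vertex 1), β (arrow 1 → 2),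
   γ (arrow 2 → 1), η (loop at vertex 2), by the path-algebra relations
   together with Erdmann's relations  βη = (αβγ)^{k-1}αβ, γβ = η^{t-1},
   ηγ = (γαβ)^{k-1}γα, βη² = 0, η²γ = 0, α² = c(αβγ)^k. -/

noncomputable section

namespace SD2Paper

inductive Gen : Type
  | e1 | e2 | a | b | g | h

variable (F : Type) [Field F]

/-- The generators inside the free algebra. -/
def gen (t : Gen) : FreeAlgebra F Gen := FreeAlgebra.ι F t

/-- The defining relations of `D(2B)^{k,s}(c)` (paths written from left to right). -/
inductive Rel (k t : ℕ) (c : F) : FreeAlgebra F Gen → FreeAlgebra F Gen → Prop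
  | unit : Rel k t c (gen F .e1 + gen F .e2) 1
  | idem1 : Rel k t c (gen F .e1 * gen F .e1) (gen F .e1)
  | idem2 : Rel k t c (gen F .e2 * gen F .e2) (gen F .e2)
  | orth12 : Rel k t c (gen F .e1 * gen F .e2) 0
  | orth21 : Rel k t c (gen F .e2 * gen F .e1) 0
  | aL : Rel k t c (gen F .e1 * gen F .a) (gen F .a)
  | aR : Rel k t c (gen F .a * gen F .e1) (gen F .a)
  | bL : Rel k t c (gen F .e1 * gen F .b) (gen F .b)
  | bR : Rel k t c (gen F .b * gen F .e2) (gen F .b)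
  | gL : Rel k t c (gen F .e2 * gen F .g) (gen F .g)
  | gR : Rel k t c (gen F .g * gen F .e1) (gen F .g)
  | hL : Rel k t c (gen F .e2 * gen F .h) (gen F .h)
  | hR : Rel k t c (gen F .h * gen F .e2) (gen F .h)
  | bh : Rel k t c (gen F .b * gen F .h)
      ((gen F .a * gen F .b * gen F .g) ^ (k - 1) * (gen F .a * gen F .b))
  | gb : Rel k t c (gen F .g * gen F .b) ((gen F .h) ^ (t - 1))
  | hg : Rel k t c (gen F .h * gen F .g)
      ((gen F .g * gen F .a * gen F .b) ^ (k - 1) * (gen F .g * gen F .a))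
  | bh2 : Rel k t c (gen F .b * gen F .h * gen F .h) 0
  | h2g : Rel k t c (gen F .h * gen F .h * gen F .g) 0
  | asq : Rel k t c (gen F .a * gen F .a) (c • (gen F .a * gen F .b * gen F .g) ^ k)

/-- The algebra `B^{k,t}_c = SD(2B)₂^{k,t}(c)`. -/
def BA (k t : ℕ) (c : F) : Type := RingQuot (Rel F k t c)

instance (k t : ℕ) (c : F) : Ring (BA F k t c) :=
  inferInstanceAs (Ring (RingQuot (Rel F k t c)))

instance (k t : ℕ) (c : F) : Algebra F (BA F k t c) :=
  inferInstanceAs (Algebra F (RingQuot (Rel F k t c)))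

variable (k t : ℕ) (c : F)

/-- The canonical projection. -/
def mk : FreeAlgebra F Gen →ₐ[F] BA F k t c := RingQuot.mkAlgHom F (Rel F k t c)

def E1 : BA F k t c := mk F k t c (gen F .e1)
def E2 : BA F k t c := mk F k t c (gen F .e2)
/-- The image of the loop α at vertex 1. -/
def Al : BA F k t c := mk F k t c (gen F .a)
/-- The image of the arrow β : 1 → 2. -/
def Be : BA F k t c := mk F k t c (gen F .b)
/-- The image of the arrow γ : 2 → 1. -/
def Ga : BA F k t c := mk F k t c (gen F .g)
/-- The image of the loop η at vertex 2. -/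
def Et : BA F k t c := mk F k t c (gen F .h)

/-- The path αβγ. -/
def ABG : BA F k t c := Al F k t c * Be F k t c * Ga F k t c
/-- The path βγα. -/
def BGA : BA F k t c := Be F k t c * Ga F k t c * Al F k t c
/-- The path γαβ. -/
def GAB : BA F k t c := Ga F k t c * Al F k t c * Be F k t c

/-- The standard basis paths 𝓑₁₁ of e₁Ae₁. -/
def B11 : Set (BA F k t c) :=
  {E1 F k t c, Al F k t c, Be F k t c * Ga F k t c, (ABG F k t c) ^ k}
    ∪ (fun i => (ABG F k t c) ^ i) '' Set.Icc 1 (k - 1)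
    ∪ (fun i => (ABG F k t c) ^ i * Al F k t c) '' Set.Icc 1 (k - 1)
    ∪ (fun i => (BGA F k t c) ^ i) '' Set.Icc 1 (k - 1)
    ∪ (fun i => (BGA F k t c) ^ i * (Be F k t c * Ga F k t c)) '' Set.Icc 1 (k - 1)

/-- The standard basis paths 𝓑₁₂ of e₁Ae₂. -/
def B12 : Set (BA F k t c) :=
  {Be F k t c, Al F k t c * Be F k t c}
    ∪ (fun i => (BGA F k t c) ^ i * Be F k t c) '' Set.Icc 1 (k - 1)
    ∪ (fun i => (ABG F k t c) ^ i * (Al F k t c * Be F k t c)) '' Set.Icc 1 (k - 1)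

/-- The standard basis paths 𝓑₂₁ of e₂Ae₁. -/
def B21 : Set (BA F k t c) :=
  {Ga F k t c, Ga F k t c * Al F k t c}
    ∪ (fun i => (GAB F k t c) ^ i * Ga F k t c) '' Set.Icc 1 (k - 1)
    ∪ (fun i => (GAB F k t c) ^ i * (Ga F k t c * Al F k t c)) '' Set.Icc 1 (k - 1)

/-- The standard basis paths 𝓑₂₂ of e₂Ae₂. -/
def B22 : Set (BA F k t c) :=
  {E2 F k t c}
    ∪ (fun i => (GAB F k t c) ^ i) '' Set.Icc 1 (k - 1)
    ∪ (fun j => (Et F k t c) ^ j) '' Set.Icc 1 t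

/-- The standard path basis 𝓑 of `A^{k,s}_c`. -/
def BB : Set (BA F k t c) :=
  B11 F k t c ∪ B12 F k t c ∪ B21 F k t c ∪ B22 F k t c

/-- The commutator subspace K(A): the F-linear span of all commutators. -/
def Kspan (A : Type) [Ring A] [Algebra F A] : Submodule F A :=
  Submodule.span F {z : A | ∃ u v : A, z = u * v - v * u}

/-- The (left) socle of a ring: the sum of all simple (left) submodules. -/
def socle (A : Type) [Ring A] : Submodule A A := sSup {S : Submodule A A | IsAtom S}

/-- `ψ` is the linear form sending each standard basis path lying in the socle to 1
    and every other standard basis path to 0. -/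
def SoclePsi (ψ : BA F k t c →ₗ[F] F) : Prop :=
  ∀ p ∈ BB F k t c,
    (p ∈ socle (BA F k t c) → ψ p = 1) ∧ (p ∉ socle (BA F k t c) → ψ p = 0)

/-- `T₁(A) = {x : x² ∈ K(A)}`. -/
def T1set : Set (BA F k t c) := {z | z ^ 2 ∈ Kspan F (BA F k t c)}

/-- The orthogonal space `T₁(A)^⊥` with respect to the form `⟨x, y⟩ = ψ(xy)`. -/
def T1perp (ψ : BA F k t c →ₗ[F] F) : Set (BA F k t c) :=
  {y | ∀ x ∈ T1set F k t c, ψ (y * x) = 0}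

/-- The first generalized Reynolds ideal, as an ideal of the center `Z(A)`. -/
def ReynoldsIdeal (ψ : BA F k t c →ₗ[F] F) :
    Ideal (Subalgebra.center F (BA F k t c)) :=
  Ideal.span {z : Subalgebra.center F (BA F k t c) | (z : BA F k t c) ∈ T1perp F k t c ψ}

section Socle

variable {K A : Type} [Field K] [Ring A] [Algebra K A]

theorem mem_socle_of_forall_mul_eq_smul {s : A} (hs : s ≠ 0)
    (h : ∀ x : A, ∃ r : K, x * s = r • s) : s ∈ socle A := by
  have hatom : IsAtom (Submodule.span A {s}) := by
    refine ⟨by simpa using hs, fun N hN => ?_⟩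
    by_contra hne
    obtain ⟨v, hv, hv0⟩ := N.ne_bot_iff.mp hne
    obtain ⟨x, rfl⟩ := Submodule.mem_span_singleton.mp (hN.le hv)
    obtain ⟨r, hr⟩ := h x
    rw [smul_eq_mul, hr] at hv hv0
    have hr0 : r ≠ 0 := fun h0 => hv0 (by rw [h0, zero_smul])
    have hsN : s ∈ N := by
      have := N.smul_mem (algebraMap K A r⁻¹) hv
      rwa [smul_eq_mul, ← Algebra.smul_def, smul_smul, inv_mul_cancel₀ hr0, one_smul] at this
    exact hN.not_ge ((Submodule.span_singleton_le_iff_mem _ _).mpr hsN)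
  exact (le_sSup hatom : Submodule.span A {s} ≤ socle A) (Submodule.mem_span_singleton_self s)

theorem notMem_socle_of_mul_eq {s p q : A} (hs : s ≠ 0)
    (h : ∀ x : A, ∃ r : K, x * s = r • s) (hqp : q * p = s) (hqs : q * s = 0) :
    p ∉ socle A := by
  intro hp
  have hss : IsSemisimpleModule A (socle A) := by
    unfold socle
    rw [sSup_eq_iSup]
    exact isSemisimpleModule_biSup_of_isSemisimpleModule_submodule fun S hS =>
      have : IsSimpleModule A S := isSimpleModule_iff_isAtom.mpr hS
      inferInstance
  have hsmem : s ∈ socle A := mem_socle_of_forall_mul_eq_smul hs h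
  obtain ⟨N, hN⟩ := exists_isCompl (Submodule.span A {(⟨s, hsmem⟩ : socle A)})
  obtain ⟨u, hu, v, hv, huv⟩ := Submodule.mem_sup.mp
    (hN.sup_eq_top ▸ Submodule.mem_top : (⟨p, hp⟩ : socle A) ∈ _)
  obtain ⟨x, rfl⟩ := Submodule.mem_span_singleton.mp hu
  obtain ⟨r, hr⟩ := h x
  have hqv : q • v = ⟨s, hsmem⟩ := by
    have hpe : r • s + (v : A) = p := by rw [← hr]; exact congrArg Subtype.val huv
    refine Subtype.ext ?_
    change q * (v : A) = s
    rw [← hqp, ← hpe, mul_add, mul_smul_comm, hqs, smul_zero, zero_add]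
  have := (Submodule.disjoint_def.mp hN.disjoint) _ (Submodule.mem_span_singleton_self _)
    (hqv ▸ N.smul_mem q hv)
  exact hs (congrArg Subtype.val this)

end Socle

theorem eq_zero_of_unitriangular_pairing {K A ι : Type} [Field K] [Ring A] [Algebra K A]
    (ψ : A →ₗ[K] K) (b d : ι → A) (s : Set ι) (r : ι → ℕ)
    (hoff : ∀ i ∈ s, ∀ j ∈ s, i ≠ j → r j ≤ r i → ψ (b i * d j) = 0)
    (hdiag : ∀ i ∈ s, ψ (b i * d i) ≠ 0) {x : A} (hx : x ∈ Submodule.span K (b '' s))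
    (hψ : ∀ y, ψ (x * y) = 0) : x = 0 := by
  classical
  obtain ⟨l, hl, rfl⟩ := (Finsupp.mem_span_image_iff_linearCombination K).mp hx
  by_contra hne
  have hl0 : l.support.Nonempty := by
    rw [Finsupp.support_nonempty_iff]
    rintro rfl
    exact hne (map_zero _)
  obtain ⟨j, hj, hmin⟩ := l.support.exists_min_image r hl0
  have hls : ∀ i ∈ l.support, i ∈ s := fun i hi => hl hi
  have := hψ (d j)
  rw [Finsupp.linearCombination_apply, Finsupp.sum, Finset.sum_mul, map_sum,
    Finset.sum_eq_single_of_mem j hj, smul_mul_assoc, map_smul, smul_eq_mul,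
    mul_eq_zero] at this
  · exact this.elim (Finsupp.mem_support_iff.mp hj) (hdiag j (hls j hj))
  · intro i hi hij
    rw [smul_mul_assoc, map_smul, hoff i (hls i hi) j (hls j hj) hij (hmin i hi), smul_zero]

/-- The relations of `SD(2B)₂^{k,t}(c)` for elements of an algebra, with `p = αβγ`, `q = βγα`,
`r = γαβ`. -/
structure IsSemidihedral {K A : Type} [Field K] [Ring A] [Algebra K A] (k t : ℕ) (c : K)
    (e₁ e₂ a b g h p q r : A) : Prop where
  one_le : 1 ≤ k
  two_le : 2 ≤ t
  four_le : 4 ≤ k + t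
  p_eq : p = a * b * g
  q_eq : q = b * g * a
  r_eq : r = g * a * b
  unit : e₁ + e₂ = 1
  idem1 : e₁ * e₁ = e₁
  idem2 : e₂ * e₂ = e₂
  orth12 : e₁ * e₂ = 0
  orth21 : e₂ * e₁ = 0
  aL : e₁ * a = a
  aR : a * e₁ = a
  bL : e₁ * b = b
  bR : b * e₂ = b
  gL : e₂ * g = g
  gR : g * e₁ = g
  hL : e₂ * h = h
  hR : h * e₂ = h
  bh : b * h = p ^ (k - 1) * (a * b)
  gb : g * b = h ^ (t - 1)
  hg : h * g = r ^ (k - 1) * (g * a)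
  bhh : b * h * h = 0
  hhg : h * h * g = 0
  asq : a * a = c • p ^ k
  adjoin : Algebra.adjoin K {e₁, e₂, a, b, g, h} = ⊤

namespace IsSemidihedral

variable {K A : Type} [Field K] [Ring A] [Algebra K A] {k t : ℕ} {c : K}
  {e₁ e₂ a b g h p q r : A}

section Relations

variable (H : IsSemidihedral k t c e₁ e₂ a b g h p q r)
include H

theorem a_mul_q_pow (n : ℕ) : a * q ^ n = p ^ n * a :=
  SemiconjBy.pow_right (show a * q = p * a by rw [H.p_eq, H.q_eq]; noncomm_ring) n

theorem b_mul_r_pow (n : ℕ) : b * r ^ n = q ^ n * b :=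
  SemiconjBy.pow_right (show b * r = q * b by rw [H.q_eq, H.r_eq]; noncomm_ring) n

theorem g_mul_p_pow (n : ℕ) : g * p ^ n = r ^ n * g :=
  SemiconjBy.pow_right (show g * p = r * g by rw [H.r_eq, H.p_eq]; noncomm_ring) n

theorem bg_mul_p_pow (n : ℕ) : b * g * p ^ n = q ^ n * (b * g) := by
  rw [mul_assoc, H.g_mul_p_pow, ← mul_assoc, H.b_mul_r_pow, mul_assoc]

theorem ga_mul_q_pow (n : ℕ) : g * a * q ^ n = r ^ n * (g * a) := by
  rw [mul_assoc, H.a_mul_q_pow, ← mul_assoc, H.g_mul_p_pow, mul_assoc]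

theorem ab_mul_r_pow (n : ℕ) : a * b * r ^ n = p ^ n * (a * b) := by
  rw [mul_assoc, H.b_mul_r_pow, ← mul_assoc, H.a_mul_q_pow, mul_assoc]

theorem p_pow_succ (n : ℕ) : p ^ (n + 1) = p ^ n * (a * b * g) := by rw [pow_succ, ← H.p_eq]

theorem q_pow_succ (n : ℕ) : q ^ (n + 1) = q ^ n * (b * g * a) := by rw [pow_succ, ← H.q_eq]

theorem r_pow_succ (n : ℕ) : r ^ (n + 1) = r ^ n * (g * a * b) := by rw [pow_succ, ← H.r_eq]

theorem p_pow_k : p ^ k = p ^ (k - 1) * (a * b * g) := by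
  rw [← H.p_pow_succ, Nat.sub_add_cancel H.one_le]

theorem q_pow_k : q ^ k = q ^ (k - 1) * (b * g * a) := by
  rw [← H.q_pow_succ, Nat.sub_add_cancel H.one_le]

theorem r_pow_k : r ^ k = r ^ (k - 1) * (g * a * b) := by
  rw [← H.r_pow_succ, Nat.sub_add_cancel H.one_le]

theorem bhg : b * h * g = p ^ k := by
  rw [H.bh, H.p_pow_k, mul_assoc]

theorem q_pow_k_eq : q ^ k = p ^ k := by
  rw [← H.bhg, mul_assoc, H.hg, H.q_pow_k, ← mul_assoc b, H.b_mul_r_pow]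
  noncomm_ring

theorem b_mul_h_pow {n : ℕ} (hn : 2 ≤ n) : b * h ^ n = 0 := by
  obtain ⟨m, rfl⟩ := Nat.exists_eq_add_of_le hn
  rw [pow_add, pow_two, ← mul_assoc, ← mul_assoc, H.bhh, zero_mul]

theorem h_pow_mul_g {n : ℕ} (hn : 2 ≤ n) : h ^ n * g = 0 := by
  obtain ⟨m, rfl⟩ := Nat.exists_eq_add_of_le' hn
  rw [pow_add, pow_two, mul_assoc, H.hhg, mul_zero]

theorem h_mul_h_pow_pred : h * h ^ (t - 1) = h ^ t := by
  rw [← pow_succ', Nat.sub_add_cancel (le_trans one_le_two H.two_le)]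

theorem h_pow_pred_mul_h : h ^ (t - 1) * h = h ^ t := by
  rw [← pow_succ, Nat.sub_add_cancel (le_trans one_le_two H.two_le)]

theorem p_pow_k_mul_b : p ^ k * b = 0 := by
  rw [← H.bhg, mul_assoc, H.gb, mul_assoc, H.h_mul_h_pow_pred, H.b_mul_h_pow H.two_le]

theorem g_mul_p_pow_k : g * p ^ k = 0 := by
  rw [← H.bhg, ← mul_assoc, ← mul_assoc, H.gb, H.h_pow_pred_mul_h, H.h_pow_mul_g H.two_le]

theorem aab : a * a * b = 0 := by
  rw [H.asq, smul_mul_assoc, H.p_pow_k_mul_b, smul_zero]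

theorem gaa : g * (a * a) = 0 := by
  rw [H.asq, mul_smul_comm, H.g_mul_p_pow_k, smul_zero]

theorem a_mul_p_pow {n : ℕ} (hn : 1 ≤ n) : a * p ^ n = 0 := by
  obtain ⟨m, rfl⟩ := Nat.exists_eq_add_of_le hn
  rw [pow_add, pow_one]
  nth_rw 1 [H.p_eq]
  rw [show a * (a * b * g * p ^ m) = a * a * b * (g * p ^ m) by noncomm_ring, H.aab, zero_mul]

theorem q_pow_mul_a {n : ℕ} (hn : 1 ≤ n) : q ^ n * a = 0 := by
  obtain ⟨m, rfl⟩ := Nat.exists_eq_add_of_le' hn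
  rw [H.q_pow_succ, show q ^ m * (b * g * a) * a = q ^ m * b * (g * (a * a)) by noncomm_ring,
    H.gaa, mul_zero]

theorem p_pow_k_mul_a : p ^ k * a = 0 := by
  rw [← H.q_pow_k_eq, H.q_pow_mul_a H.one_le]

theorem q_pow_k_mul_b : q ^ k * b = 0 := by
  rw [H.q_pow_k_eq, H.p_pow_k_mul_b]

theorem a_p_pow_ab (n : ℕ) : a * p ^ n * (a * b) = 0 := by
  rcases Nat.eq_zero_or_pos n with rfl | hn
  · rw [pow_zero, mul_one, ← mul_assoc, H.aab]
  · rw [H.a_mul_p_pow hn, zero_mul]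

theorem ga_p_pow_a (n : ℕ) : g * a * p ^ n * a = 0 := by
  rcases Nat.eq_zero_or_pos n with rfl | hn
  · rw [pow_zero, mul_one, mul_assoc, H.gaa]
  · rw [mul_assoc g, H.a_mul_p_pow hn, mul_zero, zero_mul]

theorem p_mul_b : p * b = 0 := by
  rw [H.p_eq, mul_assoc, H.gb, mul_assoc]
  rcases H.two_le.eq_or_lt with rfl | ht
  · rw [show 2 - 1 = 1 from rfl, pow_one, H.bh, ← mul_assoc, H.a_p_pow_ab]
  · rw [H.b_mul_h_pow (by omega), mul_zero]

theorem gbga : g * b * (g * a) = 0 := by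
  rw [H.gb, ← mul_assoc]
  rcases H.two_le.eq_or_lt with rfl | ht
  · rw [show 2 - 1 = 1 from rfl, pow_one, H.hg, mul_assoc, mul_assoc, H.gaa, mul_zero]
  · rw [H.h_pow_mul_g (by omega), zero_mul]

theorem p_pow_mul_b {n : ℕ} (hn : 1 ≤ n) : p ^ n * b = 0 := by
  obtain ⟨m, rfl⟩ := Nat.exists_eq_add_of_le' hn
  rw [pow_succ, mul_assoc, H.p_mul_b, mul_zero]

theorem p_pow_mul_q_pow {m n : ℕ} (hm : 1 ≤ m) (hn : 1 ≤ n) : p ^ m * q ^ n = 0 := by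
  obtain ⟨n, rfl⟩ := Nat.exists_eq_add_of_le hn
  rw [pow_add, pow_one]
  nth_rw 1 [H.q_eq]
  rw [show p ^ m * (b * g * a * q ^ n) = p ^ m * b * (g * a * q ^ n) by noncomm_ring,
    H.p_pow_mul_b hm, zero_mul]

theorem g_mul_q_pow {n : ℕ} (hn : 1 ≤ n) : g * q ^ n = 0 := by
  obtain ⟨n, rfl⟩ := Nat.exists_eq_add_of_le hn
  rw [pow_add, pow_one]
  nth_rw 1 [H.q_eq]
  rw [show g * (b * g * a * q ^ n) = g * b * (g * a) * q ^ n by noncomm_ring, H.gbga, zero_mul]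

theorem r_pow_mul_g_mul_b {n : ℕ} (hn : 1 ≤ n) : r ^ n * g * b = 0 := by
  rw [← H.g_mul_p_pow, mul_assoc, H.p_pow_mul_b hn, mul_zero]

theorem p_pow_mul_aa {n : ℕ} (hn : 1 ≤ n) : p ^ n * a * a = 0 := by
  rw [← H.a_mul_q_pow, mul_assoc, H.q_pow_mul_a hn, mul_zero]

theorem r_pow_k_eq : r ^ k = h ^ t := by
  rw [← H.h_pow_pred_mul_h, ← H.gb, mul_assoc, H.bh, ← mul_assoc, H.g_mul_p_pow, H.r_pow_k]
  noncomm_ring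

theorem r_mul_h : r * h = 0 := by
  rw [H.r_eq, mul_assoc, H.bh,
    show g * a * (p ^ (k - 1) * (a * b)) = g * a * p ^ (k - 1) * a * b by noncomm_ring,
    H.ga_p_pow_a, zero_mul]

theorem h_mul_r : h * r = 0 := by
  rw [H.r_eq, ← mul_assoc, ← mul_assoc, H.hg,
    show r ^ (k - 1) * (g * a) * a * b = r ^ (k - 1) * (g * (a * a)) * b by noncomm_ring,
    H.gaa, mul_zero, zero_mul]

theorem r_pow_mul_h {n : ℕ} (hn : 1 ≤ n) : r ^ n * h = 0 := by
  obtain ⟨m, rfl⟩ := Nat.exists_eq_add_of_le' hn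
  rw [pow_succ, mul_assoc, H.r_mul_h, mul_zero]

theorem h_mul_r_pow {n : ℕ} (hn : 1 ≤ n) : h * r ^ n = 0 := by
  obtain ⟨m, rfl⟩ := Nat.exists_eq_add_of_le hn
  rw [pow_add, pow_one, ← mul_assoc, H.h_mul_r, zero_mul]

theorem h_mul_h_pow_t : h * h ^ t = 0 := by
  rw [← H.r_pow_k_eq, H.h_mul_r_pow H.one_le]

theorem h_pow_eq_zero {n : ℕ} (hn : t < n) : h ^ n = 0 := by
  obtain ⟨m, rfl⟩ := Nat.exists_eq_add_of_le hn
  rw [pow_add, pow_succ', H.h_mul_h_pow_t, zero_mul]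

theorem p_pow_eq_zero {n : ℕ} (hn : k < n) : p ^ n = 0 := by
  obtain ⟨m, rfl⟩ := Nat.exists_eq_add_of_le hn
  rw [pow_add, H.p_pow_succ, ← mul_assoc, ← mul_assoc, H.p_pow_k_mul_a, zero_mul, zero_mul,
    zero_mul]

theorem q_pow_eq_zero {n : ℕ} (hn : k < n) : q ^ n = 0 := by
  obtain ⟨m, rfl⟩ := Nat.exists_eq_add_of_le hn
  rw [pow_add, H.q_pow_succ, ← mul_assoc, ← mul_assoc, H.q_pow_k_mul_b, zero_mul, zero_mul,
    zero_mul]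

theorem r_pow_eq_zero {n : ℕ} (hn : k < n) : r ^ n = 0 := by
  obtain ⟨m, rfl⟩ := Nat.exists_eq_add_of_le hn
  rw [pow_add, pow_succ', H.r_pow_k_eq, show r * h ^ t = 0 from ?_, zero_mul]
  rw [← H.h_mul_h_pow_pred, ← mul_assoc, H.r_mul_h, zero_mul]

theorem p_pow_mul_a_eq_zero {n : ℕ} (hn : k ≤ n) : p ^ n * a = 0 := by
  rcases hn.eq_or_lt with rfl | hn
  · exact H.p_pow_k_mul_a
  · rw [H.p_pow_eq_zero hn, zero_mul]

theorem q_pow_mul_b_eq_zero {n : ℕ} (hn : k ≤ n) : q ^ n * b = 0 := by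
  rcases hn.eq_or_lt with rfl | hn
  · exact H.q_pow_k_mul_b
  · rw [H.q_pow_eq_zero hn, zero_mul]

theorem e₁_mul_p_pow {n : ℕ} (hn : 1 ≤ n) : e₁ * p ^ n = p ^ n := by
  obtain ⟨m, rfl⟩ := Nat.exists_eq_add_of_le hn
  rw [pow_add, pow_one, H.p_eq, ← mul_assoc, ← mul_assoc, ← mul_assoc, H.aL]

theorem p_pow_mul_e₁ {n : ℕ} (hn : 1 ≤ n) : p ^ n * e₁ = p ^ n := by
  obtain ⟨m, rfl⟩ := Nat.exists_eq_add_of_le' hn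
  rw [pow_succ, mul_assoc, H.p_eq, mul_assoc _ g, H.gR]

theorem e₁_mul_q_pow {n : ℕ} (hn : 1 ≤ n) : e₁ * q ^ n = q ^ n := by
  obtain ⟨m, rfl⟩ := Nat.exists_eq_add_of_le hn
  rw [pow_add, pow_one, H.q_eq, ← mul_assoc, ← mul_assoc, ← mul_assoc, H.bL]

theorem q_pow_mul_e₁ {n : ℕ} (hn : 1 ≤ n) : q ^ n * e₁ = q ^ n := by
  obtain ⟨m, rfl⟩ := Nat.exists_eq_add_of_le' hn
  rw [pow_succ, mul_assoc, H.q_eq, mul_assoc _ a, H.aR]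

theorem e₂_mul_r_pow {n : ℕ} (hn : 1 ≤ n) : e₂ * r ^ n = r ^ n := by
  obtain ⟨m, rfl⟩ := Nat.exists_eq_add_of_le hn
  rw [pow_add, pow_one, H.r_eq, ← mul_assoc, ← mul_assoc, ← mul_assoc, H.gL]

theorem r_pow_mul_e₂ {n : ℕ} (hn : 1 ≤ n) : r ^ n * e₂ = r ^ n := by
  obtain ⟨m, rfl⟩ := Nat.exists_eq_add_of_le' hn
  rw [pow_succ, mul_assoc, H.r_eq, mul_assoc _ b, H.bR]

theorem e₁_mul_p_pow_comm (n : ℕ) : e₁ * p ^ n = p ^ n * e₁ := by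
  rcases Nat.eq_zero_or_pos n with rfl | hn
  · simp
  · rw [H.e₁_mul_p_pow hn, H.p_pow_mul_e₁ hn]

theorem e₂_mul_h_pow_comm (n : ℕ) : e₂ * h ^ n = h ^ n * e₂ :=
  ((show Commute e₂ h from H.hL.trans H.hR.symm).pow_right n).eq

theorem e₂_mul_h_pow {n : ℕ} (hn : 1 ≤ n) : e₂ * h ^ n = h ^ n := by
  obtain ⟨m, rfl⟩ := Nat.exists_eq_add_of_le hn
  rw [pow_add, pow_one, ← mul_assoc, H.hL]

theorem pa_mul_pa {m n : ℕ} (hmn : 1 ≤ m ∨ 1 ≤ n) : p ^ m * a * (p ^ n * a) = 0 := by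
  rcases Nat.eq_zero_or_pos n with rfl | hn
  · rw [pow_zero, one_mul, H.p_pow_mul_aa (by omega)]
  · rw [mul_assoc, ← mul_assoc a, H.a_mul_p_pow hn, zero_mul, mul_zero]

theorem qbg_mul_qbg {m n : ℕ} (hmn : 1 ≤ m ∨ 1 ≤ n ∨ 3 ≤ t) :
    q ^ m * (b * g) * (q ^ n * (b * g)) = 0 := by
  rcases Nat.eq_zero_or_pos n with rfl | hn
  · rw [pow_zero, one_mul, show q ^ m * (b * g) * (b * g) = q ^ m * b * g * b * g by noncomm_ring,
      ← H.b_mul_r_pow]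
    rcases Nat.eq_zero_or_pos m with rfl | hm
    · rw [pow_zero, mul_one, mul_assoc b, H.gb, H.b_mul_h_pow (by omega), zero_mul]
    · rw [mul_assoc b, mul_assoc b, H.r_pow_mul_g_mul_b hm, mul_zero, zero_mul]
  · rw [show q ^ m * (b * g) * (q ^ n * (b * g)) = q ^ m * b * (g * q ^ n) * (b * g) by
      noncomm_ring, H.g_mul_q_pow hn, mul_zero, zero_mul]

theorem qbg_mul_q (m : ℕ) {n : ℕ} (hn : 1 ≤ n) : q ^ m * (b * g) * q ^ n = 0 := by
  rw [mul_assoc, mul_assoc, H.g_mul_q_pow hn, mul_zero, mul_zero]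

theorem q_mul_pa {m : ℕ} (n : ℕ) (hm : 1 ≤ m) : q ^ m * (p ^ n * a) = 0 := by
  obtain ⟨m, rfl⟩ := Nat.exists_eq_add_of_le' hm
  rw [H.q_pow_succ, show q ^ m * (b * g * a) * (p ^ n * a) = q ^ m * b * (g * a * p ^ n * a) by
    noncomm_ring, H.ga_p_pow_a, mul_zero]

theorem rga_mul_pab (m n : ℕ) : r ^ m * (g * a) * (p ^ n * (a * b)) = 0 := by
  rw [show r ^ m * (g * a) * (p ^ n * (a * b)) = r ^ m * (g * a * p ^ n * a) * b by noncomm_ring,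
    H.ga_p_pow_a, mul_zero, zero_mul]

end Relations

end IsSemidihedral

/-- The two vertices of the quiver. -/
inductive Vertex : Type
  | one | two

/-- Names for the standard paths: `p i` stands for `(αβγ)^i`, `pa i` for `(αβγ)^i α`, and so on. -/
inductive PathIdx : Type
  | p (i : ℕ) | pa (i : ℕ) | q (i : ℕ) | qbg (i : ℕ) | qb (i : ℕ) | pab (i : ℕ)
  | rg (i : ℕ) | rga (i : ℕ) | r (i : ℕ) | h (i : ℕ)

/-- `IsPath k t i j x` says that `x` names a standard path from vertex `i` to vertex `j`. -/
inductive IsPath (k t : ℕ) : Vertex → Vertex → PathIdx → Prop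
  | p (i : ℕ) (hi : i ≤ k) : IsPath k t .one .one (.p i)
  | pa (i : ℕ) (hi : i < k) : IsPath k t .one .one (.pa i)
  | q (i : ℕ) (h1 : 1 ≤ i) (hi : i < k) : IsPath k t .one .one (.q i)
  | qbg (i : ℕ) (hi : i < k) : IsPath k t .one .one (.qbg i)
  | qb (i : ℕ) (hi : i < k) : IsPath k t .one .two (.qb i)
  | pab (i : ℕ) (hi : i < k) : IsPath k t .one .two (.pab i)
  | rg (i : ℕ) (hi : i < k) : IsPath k t .two .one (.rg i)
  | rga (i : ℕ) (hi : i < k) : IsPath k t .two .one (.rga i)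
  | r (i : ℕ) (h1 : 1 ≤ i) (hi : i < k) : IsPath k t .two .two (.r i)
  | h (i : ℕ) (hi : i ≤ t) : IsPath k t .two .two (.h i)

/-- The standard path that completes a given one to a socle path. -/
def PathIdx.dual (k t : ℕ) : PathIdx → PathIdx
  | .p i => .p (k - i)
  | .pa i => .qbg (k - 1 - i)
  | .q i => .q (k - i)
  | .qbg i => .pa (k - 1 - i)
  | .qb i => .rga (k - 1 - i)
  | .pab i => .rg (k - 1 - i)
  | .rg i => .pab (k - 1 - i)
  | .rga i => .qb (k - 1 - i)
  | .r i => .r (k - i)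
  | .h i => .h (t - i)

/-- A rank for which the pairing of standard paths with their duals is unitriangular. -/
def PathIdx.rank : PathIdx → ℕ
  | .pa i => 2 * i
  | .qbg i => 2 * i + 1
  | _ => 0

/-- The idempotent at a vertex. -/
def Vertex.idem {A : Type} (e₁ e₂ : A) : Vertex → A
  | .one => e₁
  | .two => e₂

/-- The algebra element named by a path name. -/
def PathIdx.path {A : Type} [Ring A] (e₁ e₂ a b g h p q r : A) : PathIdx → A
  | .p i => e₁ * p ^ i
  | .pa i => p ^ i * a
  | .q i => q ^ i
  | .qbg i => q ^ i * (b * g)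
  | .qb i => q ^ i * b
  | .pab i => p ^ i * (a * b)
  | .rg i => r ^ i * g
  | .rga i => r ^ i * (g * a)
  | .r i => r ^ i
  | .h i => e₂ * h ^ i

/-- The span of the standard paths from `i` to `j`. -/
def corner (K : Type) {A : Type} [Field K] [Ring A] [Algebra K A] (k t : ℕ)
    (e₁ e₂ a b g h p q r : A) (i j : Vertex) : Submodule K A :=
  Submodule.span K (PathIdx.path e₁ e₂ a b g h p q r '' {x | IsPath k t i j x})

/-- A linear form which is `1` on the socle paths and `0` on the other standard paths. -/
structure IsSocleForm {K A : Type} [Field K] [Ring A] [Algebra K A] (k t : ℕ)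
    (e₁ e₂ a b g h p q r : A) (ψ : A →ₗ[K] K) : Prop where
  p_pow_k : ψ (p ^ k) = 1
  h_pow_t : ψ (h ^ t) = 1
  eq_zero : ∀ i j x, IsPath k t i j x → x ≠ .p k → x ≠ .h t →
    ψ (PathIdx.path e₁ e₂ a b g h p q r x) = 0

namespace IsSemidihedral

open PathIdx

variable {K A : Type} [Field K] [Ring A] [Algebra K A] {k t : ℕ} {c : K}
  {e₁ e₂ a b g h p q r : A}

section Corner

theorem path_mem_corner {i j : Vertex} {x : PathIdx} (hx : IsPath k t i j x) :
    path e₁ e₂ a b g h p q r x ∈ corner K k t e₁ e₂ a b g h p q r i j :=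
  Submodule.subset_span (Set.mem_image_of_mem _ hx)

theorem corner_induction {i j : Vertex} (W : Submodule K A)
    (hW : ∀ x, IsPath k t i j x → path e₁ e₂ a b g h p q r x ∈ W) :
    ∀ v ∈ corner K k t e₁ e₂ a b g h p q r i j, v ∈ W := by
  intro v hv
  refine (Submodule.span_le.mpr ?_ : Submodule.span K _ ≤ W) hv
  rintro _ ⟨x, hx, rfl⟩
  exact hW x hx

theorem corner_mul {i j l : Vertex} {y : A}
    (hy : ∀ x, IsPath k t i j x →
      path e₁ e₂ a b g h p q r x * y ∈ corner K k t e₁ e₂ a b g h p q r i l) :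
    ∀ v ∈ corner K k t e₁ e₂ a b g h p q r i j,
      v * y ∈ corner K k t e₁ e₂ a b g h p q r i l :=
  corner_induction ((corner K k t e₁ e₂ a b g h p q r i l).comap (LinearMap.mulRight K y)) hy

theorem idem_mem_corner (i : Vertex) :
    i.idem e₁ e₂ ∈ corner K k t e₁ e₂ a b g h p q r i i := by
  cases i
  · simpa [path, Vertex.idem] using path_mem_corner (K := K) (e₁ := e₁) (e₂ := e₂) (a := a) (b := b) (g := g)
      (h := h) (p := p) (q := q) (r := r) (IsPath.p (k := k) (t := t) 0 (Nat.zero_le k))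
  · simpa [path, Vertex.idem] using path_mem_corner (K := K) (e₁ := e₁) (e₂ := e₂) (a := a) (b := b) (g := g)
      (h := h) (p := p) (q := q) (r := r) (IsPath.h (k := k) (t := t) 0 (Nat.zero_le t))

variable (H : IsSemidihedral k t c e₁ e₂ a b g h p q r)
include H

theorem idem_mul_idem_of_ne {i j : Vertex} (hij : i ≠ j) :
    i.idem e₁ e₂ * j.idem e₁ e₂ = 0 := by
  cases i <;> cases j
  · exact absurd rfl hij
  · exact H.orth12
  · exact H.orth21
  · exact absurd rfl hij

theorem corner_mul_idem {i j : Vertex} :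
    ∀ v ∈ corner K k t e₁ e₂ a b g h p q r i j, v * j.idem e₁ e₂ = v := by
  refine corner_induction (LinearMap.eqLocus (LinearMap.mulRight K (j.idem e₁ e₂)) LinearMap.id) ?_
  intro x hx
  change path e₁ e₂ a b g h p q r x * j.idem e₁ e₂ = path e₁ e₂ a b g h p q r x
  cases hx <;> simp only [path, Vertex.idem]
  · rw [H.e₁_mul_p_pow_comm, mul_assoc, H.idem1]
  · rw [mul_assoc, H.aR]
  · rw [H.q_pow_mul_e₁ (by assumption)]
  · rw [mul_assoc, mul_assoc, H.gR]
  · rw [mul_assoc, H.bR]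
  · rw [mul_assoc, mul_assoc, H.bR]
  · rw [mul_assoc, H.gR]
  · rw [mul_assoc, mul_assoc, H.aR]
  · rw [H.r_pow_mul_e₂ (by assumption)]
  · rw [H.e₂_mul_h_pow_comm, mul_assoc, H.idem2]

theorem p_pow_k_mem_corner : p ^ k ∈ corner K k t e₁ e₂ a b g h p q r .one .one := by
  rw [← H.e₁_mul_p_pow H.one_le]
  exact path_mem_corner (.p k le_rfl)

theorem corner_mul_a (i : Vertex) :
    ∀ v ∈ corner K k t e₁ e₂ a b g h p q r i .one,
      v * a ∈ corner K k t e₁ e₂ a b g h p q r i .one := by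
  refine corner_mul fun x hx => ?_
  cases hx with
  | p n hn =>
    rcases hn.eq_or_lt with rfl | hn
    · simp [path, mul_assoc, H.p_pow_k_mul_a]
    · rw [path, H.e₁_mul_p_pow_comm, mul_assoc, H.aL]
      exact path_mem_corner (.pa n hn)
  | pa n hn =>
    rcases Nat.eq_zero_or_pos n with rfl | h1
    · rw [path, pow_zero, one_mul, H.asq]
      exact Submodule.smul_mem _ _ H.p_pow_k_mem_corner
    · simp [path, H.p_pow_mul_aa h1]
  | q n h1 hn => simp [path, H.q_pow_mul_a h1]
  | qbg n hn =>
    rw [path, mul_assoc, ← H.q_pow_succ]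
    rcases (Nat.succ_le_of_lt hn).eq_or_lt with rfl | hn
    · rw [H.q_pow_k_eq]
      exact H.p_pow_k_mem_corner
    · exact path_mem_corner (.q (n + 1) (by omega) hn)
  | rg n hn =>
    rw [path, mul_assoc]
    exact path_mem_corner (.rga n hn)
  | rga n hn => simp [path, mul_assoc, H.gaa]

theorem corner_mul_b (i : Vertex) :
    ∀ v ∈ corner K k t e₁ e₂ a b g h p q r i .one,
      v * b ∈ corner K k t e₁ e₂ a b g h p q r i .two := by
  refine corner_mul fun x hx => ?_
  cases hx with
  | p n hn =>
    rcases Nat.eq_zero_or_pos n with rfl | h1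
    · rw [path, show e₁ * p ^ 0 * b = q ^ 0 * b by simp [H.bL]]
      exact path_mem_corner (.qb 0 H.one_le)
    · simp [path, mul_assoc, H.p_pow_mul_b h1]
  | pa n hn =>
    rw [path, mul_assoc]
    exact path_mem_corner (.pab n hn)
  | q n h1 hn =>
    rw [path]
    exact path_mem_corner (.qb n hn)
  | qbg n hn =>
    rcases Nat.eq_zero_or_pos n with rfl | h1
    · rw [path, pow_zero, one_mul, mul_assoc, H.gb]
      rcases H.two_le.eq_or_lt with rfl | ht
      · rw [show 2 - 1 = 1 from rfl, pow_one, H.bh]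
        exact path_mem_corner (.pab (k - 1) (by omega))
      · rw [H.b_mul_h_pow (by omega)]
        exact zero_mem _
    · rw [path, ← mul_assoc, ← H.b_mul_r_pow, mul_assoc, mul_assoc, ← mul_assoc _ g,
        H.r_pow_mul_g_mul_b h1, mul_zero]
      exact zero_mem _
  | rg n hn =>
    rcases Nat.eq_zero_or_pos n with rfl | h1
    · have ht := H.two_le
      rw [path, pow_zero, one_mul, H.gb, ← H.e₂_mul_h_pow (by omega)]
      exact path_mem_corner (.h (t - 1) (by omega))
    · rw [path, H.r_pow_mul_g_mul_b h1]
      exact zero_mem _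
  | rga n hn =>
    rw [path, mul_assoc, ← H.r_pow_succ]
    rcases (Nat.succ_le_of_lt hn).eq_or_lt with rfl | hn
    · have ht := H.two_le
      rw [H.r_pow_k_eq, ← H.e₂_mul_h_pow (by omega)]
      exact path_mem_corner (.h t le_rfl)
    · exact path_mem_corner (.r (n + 1) (by omega) hn)

theorem corner_mul_g (i : Vertex) :
    ∀ v ∈ corner K k t e₁ e₂ a b g h p q r i .two,
      v * g ∈ corner K k t e₁ e₂ a b g h p q r i .one := by
  refine corner_mul fun x hx => ?_
  cases hx with
  | qb n hn =>
    rw [path, mul_assoc]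
    exact path_mem_corner (.qbg n hn)
  | pab n hn =>
    rw [path, mul_assoc, ← H.p_pow_succ, ← H.e₁_mul_p_pow (by omega)]
    exact path_mem_corner (.p (n + 1) hn)
  | r n h1 hn =>
    rw [path]
    exact path_mem_corner (.rg n hn)
  | h n hn =>
    have hk := H.one_le
    rw [path, H.e₂_mul_h_pow_comm, mul_assoc, H.gL]
    match n with
    | 0 =>
      rw [pow_zero, ← pow_zero r]
      exact path_mem_corner (.rg 0 hk)
    | 1 =>
      rw [pow_one, H.hg]
      exact path_mem_corner (.rga (k - 1) (by omega))
    | n + 2 =>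
      rw [H.h_pow_mul_g (by omega)]
      exact zero_mem _

theorem corner_mul_h (i : Vertex) :
    ∀ v ∈ corner K k t e₁ e₂ a b g h p q r i .two,
      v * h ∈ corner K k t e₁ e₂ a b g h p q r i .two := by
  refine corner_mul fun x hx => ?_
  cases hx with
  | qb n hn =>
    rcases Nat.eq_zero_or_pos n with rfl | h1
    · rw [path, pow_zero, one_mul, H.bh]
      exact path_mem_corner (.pab (k - 1) (by omega))
    · rw [path, ← H.b_mul_r_pow, mul_assoc, H.r_pow_mul_h h1, mul_zero]
      exact zero_mem _
  | pab n hn =>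
    rw [path, mul_assoc, mul_assoc, H.bh, ← mul_assoc a, H.a_p_pow_ab, mul_zero]
    exact zero_mem _
  | r n h1 hn =>
    rw [path, H.r_pow_mul_h h1]
    exact zero_mem _
  | h n hn =>
    rw [path, mul_assoc, ← pow_succ]
    rcases hn.eq_or_lt with rfl | hn
    · rw [H.h_pow_eq_zero (Nat.lt_succ_self _), mul_zero]
      exact zero_mem _
    · exact path_mem_corner (.h (n + 1) hn)

theorem corner_mul_mul_idem (y : A) : ∀ (i j l : Vertex),
    ∀ v ∈ corner K k t e₁ e₂ a b g h p q r i j,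
      v * y * l.idem e₁ e₂ ∈ corner K k t e₁ e₂ a b g h p q r i l := by
  have hidem : ∀ (i j l : Vertex), ∀ v ∈ corner K k t e₁ e₂ a b g h p q r i j,
      v * l.idem e₁ e₂ ∈ corner K k t e₁ e₂ a b g h p q r i l := by
    intro i j l v hv
    by_cases hjl : j = l
    · subst hjl
      rwa [H.corner_mul_idem v hv]
    · rw [← H.corner_mul_idem v hv, mul_assoc, H.idem_mul_idem_of_ne hjl, mul_zero]
      exact zero_mem _
  have hgen : ∀ (z : A) (m n : Vertex), m.idem e₁ e₂ * z = z →
      (∀ i, ∀ v ∈ corner K k t e₁ e₂ a b g h p q r i m,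
        v * z ∈ corner K k t e₁ e₂ a b g h p q r i n) →
      ∀ (i j l : Vertex), ∀ v ∈ corner K k t e₁ e₂ a b g h p q r i j,
        v * z * l.idem e₁ e₂ ∈ corner K k t e₁ e₂ a b g h p q r i l := by
    intro z m n hz hmul i j l v hv
    rw [← hz, ← mul_assoc]
    exact hidem i n l _ (hmul i _ (hidem i j m v hv))
  have hy : y ∈ Algebra.adjoin K {e₁, e₂, a, b, g, h} := H.adjoin ▸ Algebra.mem_top
  induction hy using Algebra.adjoin_induction with
  | mem z hz =>
    rcases hz with rfl | rfl | rfl | rfl | rfl | rfl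
    · exact fun i j l v hv => hidem i .one l _ (hidem i j .one v hv)
    · exact fun i j l v hv => hidem i .two l _ (hidem i j .two v hv)
    · exact hgen z .one .one H.aL H.corner_mul_a
    · exact hgen z .one .two H.bL H.corner_mul_b
    · exact hgen z .two .one H.gL H.corner_mul_g
    · exact hgen z .two .two H.hL H.corner_mul_h
  | algebraMap s =>
    intro i j l v hv
    rw [← Algebra.commutes, mul_assoc, ← Algebra.smul_def]
    exact Submodule.smul_mem _ _ (hidem i j l v hv)
  | add y z _ _ hy hz =>
    intro i j l v hv
    rw [mul_add, add_mul]
    exact add_mem (hy i j l v hv) (hz i j l v hv)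
  | mul y z _ _ hy hz =>
    intro i j l v hv
    have hsplit : v * (y * z) * l.idem e₁ e₂ =
        v * y * Vertex.idem e₁ e₂ .one * z * l.idem e₁ e₂ +
        v * y * Vertex.idem e₁ e₂ .two * z * l.idem e₁ e₂ := by
      rw [← add_mul, ← add_mul, ← mul_add]
      simp only [Vertex.idem, H.unit, mul_one, mul_assoc]
    rw [hsplit]
    exact add_mem (hz i .one l _ (hy i j .one v hv)) (hz i .two l _ (hy i j .two v hv))

theorem idem_mul_mul_idem_mem_corner (x : A) (i j : Vertex) :
    i.idem e₁ e₂ * x * j.idem e₁ e₂ ∈ corner K k t e₁ e₂ a b g h p q r i j :=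
  H.corner_mul_mul_idem x i i j _ (idem_mem_corner i)

end Corner

variable {ψ : A →ₗ[K] K}

section SocleForm

theorem _root_.SD2Paper.IsSocleForm.eq_zero_of_mem_corner (Hψ : IsSocleForm k t e₁ e₂ a b g h p q r ψ)
    {i j : Vertex} (hij : i ≠ j) :
    ∀ v ∈ corner K k t e₁ e₂ a b g h p q r i j, ψ v = 0 := by
  refine corner_induction (LinearMap.ker ψ) fun x hx => ?_
  refine Hψ.eq_zero _ _ x hx ?_ ?_
  · rintro rfl
    cases hx
    exact hij rfl
  · rintro rfl
    cases hx
    exact hij rfl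

variable (H : IsSemidihedral k t c e₁ e₂ a b g h p q r)
  (Hψ : IsSocleForm k t e₁ e₂ a b g h p q r ψ)
include H Hψ

theorem form_p_pow (n : ℕ) : ψ (e₁ * p ^ n) = if n = k then 1 else 0 := by
  rcases lt_trichotomy n k with hn | rfl | hn
  · rw [if_neg hn.ne]
    exact Hψ.eq_zero _ _ _ (.p n hn.le) (by simp [hn.ne]) (by simp)
  · rw [if_pos rfl, H.e₁_mul_p_pow H.one_le, Hψ.p_pow_k]
  · rw [if_neg hn.ne', H.p_pow_eq_zero hn, mul_zero, map_zero]

theorem form_q_pow {n : ℕ} (h1 : 1 ≤ n) : ψ (q ^ n) = if n = k then 1 else 0 := by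
  rcases lt_trichotomy n k with hn | rfl | hn
  · rw [if_neg hn.ne]
    exact Hψ.eq_zero _ _ _ (.q n h1 hn) (by simp) (by simp)
  · rw [if_pos rfl, H.q_pow_k_eq, Hψ.p_pow_k]
  · rw [if_neg hn.ne', H.q_pow_eq_zero hn, map_zero]

theorem form_r_pow {n : ℕ} (h1 : 1 ≤ n) : ψ (r ^ n) = if n = k then 1 else 0 := by
  rcases lt_trichotomy n k with hn | rfl | hn
  · rw [if_neg hn.ne]
    exact Hψ.eq_zero _ _ _ (.r n h1 hn) (by simp) (by simp)
  · rw [if_pos rfl, H.r_pow_k_eq, Hψ.h_pow_t]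
  · rw [if_neg hn.ne', H.r_pow_eq_zero hn, map_zero]

theorem form_h_pow (n : ℕ) : ψ (e₂ * h ^ n) = if n = t then 1 else 0 := by
  have ht := H.two_le
  rcases lt_trichotomy n t with hn | rfl | hn
  · rw [if_neg hn.ne]
    exact Hψ.eq_zero _ _ _ (.h n hn.le) (by simp) (by simp [hn.ne])
  · rw [if_pos rfl, H.e₂_mul_h_pow (by omega), Hψ.h_pow_t]
  · rw [if_neg hn.ne', H.h_pow_eq_zero hn, mul_zero, map_zero]

theorem form_pa (n : ℕ) : ψ (p ^ n * a) = 0 := by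
  rcases lt_or_ge n k with hn | hn
  · exact Hψ.eq_zero _ _ _ (.pa n hn) (by simp) (by simp)
  · rw [H.p_pow_mul_a_eq_zero hn, map_zero]

theorem form_qbg (n : ℕ) : ψ (q ^ n * (b * g)) = 0 := by
  rcases lt_or_ge n k with hn | hn
  · exact Hψ.eq_zero _ _ _ (.qbg n hn) (by simp) (by simp)
  · rw [← mul_assoc, H.q_pow_mul_b_eq_zero hn, zero_mul, map_zero]

theorem form_p_pow_succ (n : ℕ) : ψ (p ^ (n + 1)) = if n + 1 = k then 1 else 0 := by
  rw [← H.form_p_pow Hψ, H.e₁_mul_p_pow (by omega)]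

theorem form_p_mul_p (m n : ℕ) :
    ψ (e₁ * p ^ m * (e₁ * p ^ n)) = if m + n = k then 1 else 0 := by
  rw [← H.form_p_pow Hψ, H.e₁_mul_p_pow_comm n, pow_add, ← mul_assoc, mul_assoc e₁, ← pow_add,
    H.e₁_mul_p_pow_comm, mul_assoc, H.idem1]

theorem form_p_mul_qbg (m n : ℕ) : ψ (e₁ * p ^ m * (q ^ n * (b * g))) = 0 := by
  rcases Nat.eq_zero_or_pos m with rfl | hm
  · have : e₁ * (q ^ n * (b * g)) = q ^ n * (b * g) := by
      rcases Nat.eq_zero_or_pos n with rfl | hn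
      · rw [pow_zero, one_mul, ← mul_assoc, H.bL]
      · rw [← mul_assoc, H.e₁_mul_q_pow hn]
    rw [pow_zero, mul_one, this, H.form_qbg Hψ]
  · rcases Nat.eq_zero_or_pos n with rfl | hn
    · rw [pow_zero, one_mul, ← mul_assoc, mul_assoc e₁, H.p_pow_mul_b hm, mul_zero, zero_mul,
        map_zero]
    · rw [← mul_assoc, mul_assoc e₁, H.p_pow_mul_q_pow hm hn, mul_zero, zero_mul, map_zero]

theorem form_p_mul_pa (m n : ℕ) : ψ (e₁ * p ^ m * (p ^ n * a)) = 0 := by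
  rw [← mul_assoc, mul_assoc e₁, ← pow_add, H.e₁_mul_p_pow_comm, mul_assoc, H.aL, H.form_pa Hψ]

theorem form_p_mul_q (m : ℕ) {n : ℕ} (hn : 1 ≤ n) (hnk : n < k) :
    ψ (e₁ * p ^ m * q ^ n) = 0 := by
  rcases Nat.eq_zero_or_pos m with rfl | hm
  · rw [pow_zero, mul_one, H.e₁_mul_q_pow hn, H.form_q_pow Hψ hn, if_neg hnk.ne]
  · rw [mul_assoc, H.p_pow_mul_q_pow hm hn, mul_zero, map_zero]

theorem form_pa_mul_p (m n : ℕ) : ψ (p ^ m * a * (e₁ * p ^ n)) = 0 := by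
  rw [← mul_assoc, mul_assoc _ a, H.aR]
  rcases Nat.eq_zero_or_pos n with rfl | hn
  · rw [pow_zero, mul_one, H.form_pa Hψ]
  · rw [mul_assoc, H.a_mul_p_pow hn, mul_zero, map_zero]

theorem form_pa_mul_qbg (m n : ℕ) :
    ψ (p ^ m * a * (q ^ n * (b * g))) = if m + n + 1 = k then 1 else 0 := by
  rw [← H.form_p_pow_succ Hψ, H.p_pow_succ, pow_add,
    show p ^ m * a * (q ^ n * (b * g)) = p ^ m * (a * q ^ n) * (b * g) by noncomm_ring,
    H.a_mul_q_pow]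
  congr 1
  noncomm_ring

theorem form_pa_mul_q (m n : ℕ) : ψ (p ^ m * a * q ^ n) = 0 := by
  rw [mul_assoc, H.a_mul_q_pow, ← mul_assoc, ← pow_add, H.form_pa Hψ]

theorem form_qbg_mul_p (m n : ℕ) : ψ (q ^ m * (b * g) * (e₁ * p ^ n)) = 0 := by
  rw [show q ^ m * (b * g) * (e₁ * p ^ n) = q ^ m * (b * (g * e₁) * p ^ n) by noncomm_ring, H.gR,
    H.bg_mul_p_pow, ← mul_assoc, ← pow_add, H.form_qbg Hψ]

theorem form_qbg_mul_pa (m n : ℕ) :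
    ψ (q ^ m * (b * g) * (p ^ n * a)) = if m + n + 1 = k then 1 else 0 := by
  rw [← H.form_q_pow Hψ (by omega), H.q_pow_succ,
    show q ^ m * (b * g) * (p ^ n * a) = q ^ m * (b * g * p ^ n) * a by noncomm_ring,
    H.bg_mul_p_pow, pow_add]
  congr 1
  noncomm_ring

theorem form_q_mul_p {m : ℕ} (n : ℕ) (hm : 1 ≤ m) (hmk : m < k) :
    ψ (q ^ m * (e₁ * p ^ n)) = 0 := by
  rw [← mul_assoc, H.q_pow_mul_e₁ hm]
  rcases Nat.eq_zero_or_pos n with rfl | hn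
  · rw [pow_zero, mul_one, H.form_q_pow Hψ hm, if_neg hmk.ne]
  · obtain ⟨m, rfl⟩ := Nat.exists_eq_add_of_le' hm
    rw [H.q_pow_succ, mul_assoc, mul_assoc _ a, H.a_mul_p_pow hn, mul_zero, mul_zero, map_zero]

theorem form_q_mul_qbg (m n : ℕ) : ψ (q ^ m * (q ^ n * (b * g))) = 0 := by
  rw [← mul_assoc, ← pow_add, H.form_qbg Hψ]

theorem form_qb_mul_rga (m n : ℕ) :
    ψ (q ^ m * b * (r ^ n * (g * a))) = if m + n + 1 = k then 1 else 0 := by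
  rw [← H.form_q_pow Hψ (by omega), H.q_pow_succ,
    show q ^ m * b * (r ^ n * (g * a)) = q ^ m * (b * r ^ n) * (g * a) by noncomm_ring,
    H.b_mul_r_pow, pow_add]
  congr 1
  noncomm_ring

theorem form_qb_mul_rg (m n : ℕ) : ψ (q ^ m * b * (r ^ n * g)) = 0 := by
  rw [show q ^ m * b * (r ^ n * g) = q ^ m * (b * r ^ n) * g by noncomm_ring, H.b_mul_r_pow,
    ← mul_assoc, ← pow_add, mul_assoc, H.form_qbg Hψ]

theorem form_pab_mul_rga (m n : ℕ) : ψ (p ^ m * (a * b) * (r ^ n * (g * a))) = 0 := by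
  rw [show p ^ m * (a * b) * (r ^ n * (g * a)) = p ^ m * (a * b * r ^ n) * g * a by noncomm_ring,
    H.ab_mul_r_pow, ← mul_assoc, ← pow_add, mul_assoc _ _ g, ← H.p_pow_succ, H.form_pa Hψ]

theorem form_pab_mul_rg (m n : ℕ) :
    ψ (p ^ m * (a * b) * (r ^ n * g)) = if m + n + 1 = k then 1 else 0 := by
  rw [← H.form_p_pow_succ Hψ,
    show p ^ m * (a * b) * (r ^ n * g) = p ^ m * (a * b * r ^ n) * g by noncomm_ring,
    H.ab_mul_r_pow, ← mul_assoc, ← pow_add, mul_assoc _ _ g, ← H.p_pow_succ]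

theorem form_rg_mul_pab (m n : ℕ) :
    ψ (r ^ m * g * (p ^ n * (a * b))) = if m + n + 1 = k then 1 else 0 := by
  rw [← H.form_r_pow Hψ (by omega), H.r_pow_succ,
    show r ^ m * g * (p ^ n * (a * b)) = r ^ m * (g * p ^ n) * (a * b) by noncomm_ring,
    H.g_mul_p_pow, pow_add]
  congr 1
  noncomm_ring

theorem form_rg_mul_b (n : ℕ) : ψ (r ^ n * g * b) = 0 := by
  rcases Nat.eq_zero_or_pos n with rfl | hn
  · have ht := H.two_le
    rw [pow_zero, one_mul, H.gb, ← H.e₂_mul_h_pow (by omega), H.form_h_pow Hψ, if_neg (by omega)]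
  · rw [H.r_pow_mul_g_mul_b hn, map_zero]

theorem form_rg_mul_qb (m n : ℕ) : ψ (r ^ m * g * (q ^ n * b)) = 0 := by
  rcases Nat.eq_zero_or_pos n with rfl | hn
  · rw [pow_zero, one_mul, H.form_rg_mul_b Hψ]
  · rw [← mul_assoc, mul_assoc _ g, H.g_mul_q_pow hn, mul_zero, zero_mul, map_zero]

theorem form_rga_mul_qb (m n : ℕ) :
    ψ (r ^ m * (g * a) * (q ^ n * b)) = if m + n + 1 = k then 1 else 0 := by
  rw [← H.form_r_pow Hψ (by omega), H.r_pow_succ,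
    show r ^ m * (g * a) * (q ^ n * b) = r ^ m * (g * a * q ^ n) * b by noncomm_ring,
    H.ga_mul_q_pow, pow_add]
  congr 1
  noncomm_ring

theorem form_r_mul_h {m : ℕ} (n : ℕ) (hm : 1 ≤ m) (hmk : m < k) :
    ψ (r ^ m * (e₂ * h ^ n)) = 0 := by
  rw [← mul_assoc, H.r_pow_mul_e₂ hm]
  rcases Nat.eq_zero_or_pos n with rfl | hn
  · rw [pow_zero, mul_one, H.form_r_pow Hψ hm, if_neg hmk.ne]
  · obtain ⟨n, rfl⟩ := Nat.exists_eq_add_of_le hn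
    rw [pow_add, pow_one, ← mul_assoc, H.r_pow_mul_h hm, zero_mul, map_zero]

theorem form_h_mul_r (m : ℕ) {n : ℕ} (hn : 1 ≤ n) (hnk : n < k) :
    ψ (e₂ * h ^ m * r ^ n) = 0 := by
  rcases Nat.eq_zero_or_pos m with rfl | hm
  · rw [pow_zero, mul_one, H.e₂_mul_r_pow hn, H.form_r_pow Hψ hn, if_neg hnk.ne]
  · obtain ⟨m, rfl⟩ := Nat.exists_eq_add_of_le' hm
    rw [pow_succ, mul_assoc, mul_assoc, H.h_mul_r_pow hn, mul_zero, mul_zero, map_zero]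

theorem form_h_mul_h (m n : ℕ) :
    ψ (e₂ * h ^ m * (e₂ * h ^ n)) = if m + n = t then 1 else 0 := by
  rw [← H.form_h_pow Hψ, H.e₂_mul_h_pow_comm n, pow_add, ← mul_assoc, mul_assoc e₂, ← pow_add,
    H.e₂_mul_h_pow_comm, mul_assoc, H.idem2]

theorem form_path_mul_dual_self {i j : Vertex} {x : PathIdx} (hx : IsPath k t i j x) :
    ψ (path e₁ e₂ a b g h p q r x * path e₁ e₂ a b g h p q r (x.dual k t)) ≠ 0 := by
  cases hx <;> simp only [path, dual]
  · rw [H.form_p_mul_p Hψ, if_pos (by omega)]; exact one_ne_zero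
  · rw [H.form_pa_mul_qbg Hψ, if_pos (by omega)]; exact one_ne_zero
  · rw [← pow_add, H.form_q_pow Hψ (by omega), if_pos (by omega)]; exact one_ne_zero
  · rw [H.form_qbg_mul_pa Hψ, if_pos (by omega)]; exact one_ne_zero
  · rw [H.form_qb_mul_rga Hψ, if_pos (by omega)]; exact one_ne_zero
  · rw [H.form_pab_mul_rg Hψ, if_pos (by omega)]; exact one_ne_zero
  · rw [H.form_rg_mul_pab Hψ, if_pos (by omega)]; exact one_ne_zero
  · rw [H.form_rga_mul_qb Hψ, if_pos (by omega)]; exact one_ne_zero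
  · rw [← pow_add, H.form_r_pow Hψ (by omega), if_pos (by omega)]; exact one_ne_zero
  · rw [H.form_h_mul_h Hψ, if_pos (by omega)]; exact one_ne_zero

theorem form_path_mul_dual {i j : Vertex} {x y : PathIdx} (hx : IsPath k t i j x)
    (hy : IsPath k t i j y) (hxy : x ≠ y) (hrank : y.rank ≤ x.rank) :
    ψ (path e₁ e₂ a b g h p q r x * path e₁ e₂ a b g h p q r (y.dual k t)) = 0 := by
  have hk := H.one_le
  have h4 := H.four_le
  cases hx with
  | p m hm =>
    cases hy with
    | p n hn =>
      have : m ≠ n := fun e => hxy (e ▸ rfl)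
      exact (H.form_p_mul_p Hψ _ _).trans (if_neg (by omega))
    | pa n hn => exact H.form_p_mul_qbg Hψ _ _
    | qbg n hn => exact H.form_p_mul_pa Hψ _ _
    | q n h1 hn => exact H.form_p_mul_q Hψ _ (by omega) (by omega)
  | pa m hm =>
    cases hy with
    | p n hn => exact H.form_pa_mul_p Hψ _ _
    | pa n hn =>
      have : m ≠ n := fun e => hxy (e ▸ rfl)
      exact (H.form_pa_mul_qbg Hψ _ _).trans (if_neg (by omega))
    | qbg n hn =>
      simp only [rank] at hrank
      rw [path, dual, path, H.pa_mul_pa (by omega), map_zero]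
    | q n h1 hn => exact H.form_pa_mul_q Hψ _ _
  | qbg m hm =>
    cases hy with
    | p n hn => exact H.form_qbg_mul_p Hψ _ _
    | pa n hn =>
      simp only [rank] at hrank
      rw [path, dual, path, H.qbg_mul_qbg (by omega), map_zero]
    | qbg n hn =>
      have : m ≠ n := fun e => hxy (e ▸ rfl)
      exact (H.form_qbg_mul_pa Hψ _ _).trans (if_neg (by omega))
    | q n h1 hn => rw [path, dual, path, H.qbg_mul_q _ (by omega), map_zero]
  | q m h1m hm =>
    cases hy with
    | p n hn => exact H.form_q_mul_p Hψ _ h1m hm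
    | pa n hn => exact H.form_q_mul_qbg Hψ _ _
    | qbg n hn => rw [path, dual, path, H.q_mul_pa _ h1m, map_zero]
    | q n h1 hn =>
      have : m ≠ n := fun e => hxy (e ▸ rfl)
      rw [path, dual, path, ← pow_add, H.form_q_pow Hψ (by omega), if_neg (by omega)]
  | qb m hm =>
    cases hy with
    | qb n hn =>
      have : m ≠ n := fun e => hxy (e ▸ rfl)
      exact (H.form_qb_mul_rga Hψ _ _).trans (if_neg (by omega))
    | pab n hn => exact H.form_qb_mul_rg Hψ _ _
  | pab m hm =>
    cases hy with
    | qb n hn => exact H.form_pab_mul_rga Hψ _ _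
    | pab n hn =>
      have : m ≠ n := fun e => hxy (e ▸ rfl)
      exact (H.form_pab_mul_rg Hψ _ _).trans (if_neg (by omega))
  | rg m hm =>
    cases hy with
    | rg n hn =>
      have : m ≠ n := fun e => hxy (e ▸ rfl)
      exact (H.form_rg_mul_pab Hψ _ _).trans (if_neg (by omega))
    | rga n hn => exact H.form_rg_mul_qb Hψ _ _
  | rga m hm =>
    cases hy with
    | rg n hn => rw [path, dual, path, H.rga_mul_pab _ _, map_zero]
    | rga n hn =>
      have : m ≠ n := fun e => hxy (e ▸ rfl)
      exact (H.form_rga_mul_qb Hψ _ _).trans (if_neg (by omega))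
  | r m h1m hm =>
    cases hy with
    | r n h1 hn =>
      have : m ≠ n := fun e => hxy (e ▸ rfl)
      rw [path, dual, path, ← pow_add, H.form_r_pow Hψ (by omega), if_neg (by omega)]
    | h n hn => exact H.form_r_mul_h Hψ _ h1m hm
  | h m hm =>
    cases hy with
    | r n h1 hn => exact H.form_h_mul_r Hψ _ (by omega) (by omega)
    | h n hn =>
      have : m ≠ n := fun e => hxy (e ▸ rfl)
      exact (H.form_h_mul_h Hψ _ _).trans (if_neg (by omega))

theorem form_mul_idem_comm (i : Vertex) (x : A) :
    ψ (x * i.idem e₁ e₂) = ψ (i.idem e₁ e₂ * x) := by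
  have h12 : ψ (e₁ * x * e₂) = 0 := Hψ.eq_zero_of_mem_corner (i := .one) (j := .two)
    (by simp) _ (H.idem_mul_mul_idem_mem_corner x .one .two)
  have h21 : ψ (e₂ * x * e₁) = 0 := Hψ.eq_zero_of_mem_corner (i := .two) (j := .one)
    (by simp) _ (H.idem_mul_mul_idem_mem_corner x .two .one)
  have hl : ∀ z, ψ z = ψ (e₁ * z) + ψ (e₂ * z) := fun z => by
    rw [← map_add, ← add_mul, H.unit, one_mul]
  have hr : ∀ z, ψ z = ψ (z * e₁) + ψ (z * e₂) := fun z => by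
    rw [← map_add, ← mul_add, H.unit, mul_one]
  cases i
  · rw [hl, hr (Vertex.idem e₁ e₂ .one * x)]
    simp only [Vertex.idem, ← mul_assoc, h12, h21, add_zero]
  · rw [hl, hr (Vertex.idem e₁ e₂ .two * x)]
    simp only [Vertex.idem, ← mul_assoc, h12, h21, zero_add]

theorem form_mul_comm_of_corner {i j : Vertex} {y : A} (hl : i.idem e₁ e₂ * y = y)
    (hr : y * j.idem e₁ e₂ = y)
    (hy : ∀ x, IsPath k t j i x →
      ψ (path e₁ e₂ a b g h p q r x * y) = ψ (y * path e₁ e₂ a b g h p q r x)) (x : A) :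
    ψ (x * y) = ψ (y * x) := by
  have hcorner := corner_induction (LinearMap.eqLocus (ψ ∘ₗ LinearMap.mulRight K y)
    (ψ ∘ₗ LinearMap.mulLeft K y)) hy _ (H.idem_mul_mul_idem_mem_corner x j i)
  change ψ (j.idem e₁ e₂ * x * i.idem e₁ e₂ * y) = ψ (y * (j.idem e₁ e₂ * x * i.idem e₁ e₂))
    at hcorner
  calc ψ (x * y) = ψ (x * y * j.idem e₁ e₂) := by rw [mul_assoc, hr]
    _ = ψ (j.idem e₁ e₂ * x * i.idem e₁ e₂ * y) := by
      rw [H.form_mul_idem_comm Hψ, mul_assoc _ _ y, hl, mul_assoc]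
    _ = ψ (y * x * i.idem e₁ e₂) := by
      rw [hcorner, ← mul_assoc, ← mul_assoc, hr]
    _ = ψ (y * x) := by rw [H.form_mul_idem_comm Hψ, ← mul_assoc, hl]

theorem form_mul_a_comm (x : A) : ψ (x * a) = ψ (a * x) := by
  refine H.form_mul_comm_of_corner Hψ (i := .one) (j := .one) H.aL H.aR (fun x hx => ?_) x
  cases hx with
  | p n hn =>
    rw [path, H.e₁_mul_p_pow_comm, mul_assoc, H.aL, H.form_pa Hψ, ← H.e₁_mul_p_pow_comm]
    have := H.form_pa_mul_p Hψ 0 n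
    rwa [pow_zero, one_mul, eq_comm] at this
  | pa n hn =>
    rcases Nat.eq_zero_or_pos n with rfl | h1
    · simp [path]
    · rw [path, H.p_pow_mul_aa h1, ← mul_assoc, H.a_mul_p_pow h1, zero_mul]
  | q n h1 hn => rw [path, H.q_pow_mul_a h1, H.a_mul_q_pow, H.form_pa Hψ, map_zero]
  | qbg n hn =>
    rw [path, mul_assoc, ← H.q_pow_succ, ← mul_assoc, H.a_mul_q_pow, mul_assoc, ← mul_assoc a,
      ← H.p_pow_succ, H.form_q_pow Hψ (by omega), H.form_p_pow_succ Hψ]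

theorem form_mul_b_comm (x : A) : ψ (x * b) = ψ (b * x) := by
  refine H.form_mul_comm_of_corner Hψ (i := .one) (j := .two) H.bL H.bR (fun x hx => ?_) x
  cases hx with
  | rg n hn =>
    rw [path, H.form_rg_mul_b Hψ, ← mul_assoc, H.b_mul_r_pow, mul_assoc, H.form_qbg Hψ]
  | rga n hn =>
    rw [path, mul_assoc, ← H.r_pow_succ, ← mul_assoc, H.b_mul_r_pow, mul_assoc, ← mul_assoc b,
      ← H.q_pow_succ, H.form_q_pow Hψ (by omega), H.form_r_pow Hψ (by omega)]

theorem form_mul_g_comm (x : A) : ψ (x * g) = ψ (g * x) := by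
  refine H.form_mul_comm_of_corner Hψ (i := .two) (j := .one) H.gL H.gR (fun x hx => ?_) x
  cases hx with
  | qb n hn =>
    have := H.form_rg_mul_qb Hψ 0 n
    rw [pow_zero, one_mul] at this
    rw [path, this, mul_assoc, H.form_qbg Hψ]
  | pab n hn =>
    rw [path, mul_assoc, ← H.p_pow_succ, ← mul_assoc, H.g_mul_p_pow, mul_assoc, ← mul_assoc g,
      ← H.r_pow_succ, H.form_p_pow_succ Hψ, H.form_r_pow Hψ (by omega)]

theorem form_mul_h_comm (x : A) : ψ (x * h) = ψ (h * x) := by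
  refine H.form_mul_comm_of_corner Hψ (i := .two) (j := .two) H.hL H.hR (fun x hx => ?_) x
  cases hx with
  | r n h1 hn => rw [path, H.r_pow_mul_h h1, H.h_mul_r_pow h1]
  | h n hn => rw [path, ← mul_assoc, H.hR, H.e₂_mul_h_pow_comm, mul_assoc, H.hL, ← pow_succ,
      ← pow_succ']

theorem form_mul_comm (x y : A) : ψ (x * y) = ψ (y * x) := by
  have hy : y ∈ Algebra.adjoin K {e₁, e₂, a, b, g, h} := H.adjoin ▸ Algebra.mem_top
  induction hy using Algebra.adjoin_induction generalizing x with
  | mem z hz =>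
    rcases hz with rfl | rfl | rfl | rfl | rfl | rfl
    · exact H.form_mul_idem_comm Hψ .one x
    · exact H.form_mul_idem_comm Hψ .two x
    · exact H.form_mul_a_comm Hψ x
    · exact H.form_mul_b_comm Hψ x
    · exact H.form_mul_g_comm Hψ x
    · exact H.form_mul_h_comm Hψ x
  | algebraMap s => rw [Algebra.commutes]
  | add y z _ _ hy hz => rw [mul_add, add_mul, map_add, map_add, hy, hz]
  | mul y z _ _ hy hz => rw [← mul_assoc, hz, ← mul_assoc, hy, ← mul_assoc]

theorem eq_zero_of_form_mul_eq_zero (x : A) (hx : ∀ y, ψ (x * y) = 0) : x = 0 := by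
  have hcorner : ∀ i j : Vertex, i.idem e₁ e₂ * x * j.idem e₁ e₂ = 0 := by
    intro i j
    refine eq_zero_of_unitriangular_pairing ψ (path e₁ e₂ a b g h p q r)
      (fun y => path e₁ e₂ a b g h p q r (y.dual k t)) {y | IsPath k t i j y} rank
      (fun y hy z hz => H.form_path_mul_dual Hψ hy hz)
      (fun y hy => H.form_path_mul_dual_self Hψ hy)
      (H.idem_mul_mul_idem_mem_corner x i j) fun y => ?_
    rw [mul_assoc, mul_assoc, H.form_mul_comm Hψ, mul_assoc, hx]
  calc x = (e₁ + e₂) * x * (e₁ + e₂) := by rw [H.unit, one_mul, mul_one]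
    _ = e₁ * x * e₁ + e₁ * x * e₂ + (e₂ * x * e₁ + e₂ * x * e₂) := by noncomm_ring
    _ = 0 := by
      have h11 := hcorner .one .one
      have h12 := hcorner .one .two
      have h21 := hcorner .two .one
      have h22 := hcorner .two .two
      simp only [Vertex.idem] at h11 h12 h21 h22
      rw [h11, h12, h21, h22, add_zero, add_zero]

end SocleForm

section Socle

variable (H : IsSemidihedral k t c e₁ e₂ a b g h p q r)
include H

theorem exists_mul_eq_smul {s : A}
    (hs : ∀ y ∈ ({e₁, e₂, a, b, g, h} : Set A), y * s = s ∨ y * s = 0) (x : A) :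
    ∃ z : K, x * s = z • s := by
  have hx : x ∈ Algebra.adjoin K {e₁, e₂, a, b, g, h} := H.adjoin ▸ Algebra.mem_top
  induction hx using Algebra.adjoin_induction with
  | mem y hy =>
    rcases hs y hy with h1 | h0
    · exact ⟨1, by rw [h1, one_smul]⟩
    · exact ⟨0, by rw [h0, zero_smul]⟩
  | algebraMap z => exact ⟨z, (Algebra.smul_def z s).symm⟩
  | add y z _ _ hy hz =>
    obtain ⟨u, hu⟩ := hy
    obtain ⟨v, hv⟩ := hz
    exact ⟨u + v, by rw [add_mul, hu, hv, add_smul]⟩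
  | mul y z _ _ hy hz =>
    obtain ⟨u, hu⟩ := hy
    obtain ⟨v, hv⟩ := hz
    exact ⟨v * u, by rw [mul_assoc, hv, mul_smul_comm, hu, smul_smul]⟩

theorem b_mul_p_pow_k : b * p ^ k = 0 := by
  rw [← H.e₁_mul_p_pow H.one_le, ← H.bR, mul_assoc, ← mul_assoc e₂, H.orth21, zero_mul, mul_zero]

theorem a_mul_h_pow_t : a * h ^ t = 0 := by
  rw [← H.e₂_mul_h_pow (le_trans one_le_two H.two_le), ← H.aR, mul_assoc, ← mul_assoc e₁, H.orth12,
    zero_mul, mul_zero]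

theorem g_mul_h_pow_t : g * h ^ t = 0 := by
  rw [← H.e₂_mul_h_pow (le_trans one_le_two H.two_le), ← H.gR, mul_assoc, ← mul_assoc e₁, H.orth12,
    zero_mul, mul_zero]

theorem p_pow_mul_p_pow_k {n : ℕ} (hn : 1 ≤ n) : p ^ n * p ^ k = 0 := by
  rw [← pow_add, H.p_pow_eq_zero (by omega)]

theorem exists_mul_p_pow_k_eq_smul (x : A) : ∃ z : K, x * p ^ k = z • p ^ k := by
  refine H.exists_mul_eq_smul ?_ x
  rintro y (rfl | rfl | rfl | rfl | rfl | rfl)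
  · exact .inl (H.e₁_mul_p_pow H.one_le)
  · exact .inr (by rw [← H.e₁_mul_p_pow H.one_le, ← mul_assoc, H.orth21, zero_mul])
  · exact .inr (H.a_mul_p_pow H.one_le)
  · exact .inr H.b_mul_p_pow_k
  · exact .inr H.g_mul_p_pow_k
  · exact .inr (by rw [← H.e₁_mul_p_pow H.one_le, ← H.hR, mul_assoc, ← mul_assoc e₂, H.orth21,
      zero_mul, mul_zero])

theorem exists_mul_h_pow_t_eq_smul (x : A) : ∃ z : K, x * h ^ t = z • h ^ t := by
  have ht : 1 ≤ t := le_trans one_le_two H.two_le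
  refine H.exists_mul_eq_smul ?_ x
  rintro y (rfl | rfl | rfl | rfl | rfl | rfl)
  · exact .inr (by rw [← H.e₂_mul_h_pow ht, ← mul_assoc, H.orth12, zero_mul])
  · exact .inl (H.e₂_mul_h_pow ht)
  · exact .inr H.a_mul_h_pow_t
  · exact .inr (H.b_mul_h_pow H.two_le)
  · exact .inr H.g_mul_h_pow_t
  · exact .inr H.h_mul_h_pow_t

theorem isSocleForm
    (hψ : ∀ i j x, IsPath k t i j x →
      (path e₁ e₂ a b g h p q r x ∈ socle A → ψ (path e₁ e₂ a b g h p q r x) = 1) ∧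
      (path e₁ e₂ a b g h p q r x ∉ socle A → ψ (path e₁ e₂ a b g h p q r x) = 0)) :
    IsSocleForm k t e₁ e₂ a b g h p q r ψ := by
  have hk := H.one_le
  have ht := H.two_le
  have socle_value : ∀ {s : A}, (∀ x : A, ∃ z : K, x * s = z • s) →
      (s ∈ socle A → ψ s = 1) → ψ s = 1 ∧ s ≠ 0 := by
    intro s hs h1
    have hmem : s ∈ socle A := by
      by_cases h0 : s = 0
      · exact h0 ▸ zero_mem _
      · exact mem_socle_of_forall_mul_eq_smul h0 hs
    refine ⟨h1 hmem, fun h0 => ?_⟩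
    have := h1 hmem
    rw [h0, map_zero] at this
    exact zero_ne_one this
  obtain ⟨hp1, hp0⟩ := socle_value H.exists_mul_p_pow_k_eq_smul
    (by simpa only [path, H.e₁_mul_p_pow hk] using (hψ _ _ _ (.p k le_rfl)).1)
  obtain ⟨hh1, hh0⟩ := socle_value H.exists_mul_h_pow_t_eq_smul
    (by simpa only [path, H.e₂_mul_h_pow (one_le_two.trans ht)] using (hψ _ _ _ (.h t le_rfl)).1)
  refine ⟨hp1, hh1, fun i j x hx hxp hxh => (hψ i j x hx).2 ?_⟩
  have hp : ∀ y : PathIdx, path e₁ e₂ a b g h p q r y * path e₁ e₂ a b g h p q r x = p ^ k →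
      path e₁ e₂ a b g h p q r y * p ^ k = 0 → path e₁ e₂ a b g h p q r x ∉ socle A :=
    fun y => notMem_socle_of_mul_eq hp0 H.exists_mul_p_pow_k_eq_smul
  have hh : ∀ y : PathIdx, path e₁ e₂ a b g h p q r y * path e₁ e₂ a b g h p q r x = h ^ t →
      path e₁ e₂ a b g h p q r y * h ^ t = 0 → path e₁ e₂ a b g h p q r x ∉ socle A :=
    fun y => notMem_socle_of_mul_eq hh0 H.exists_mul_h_pow_t_eq_smul
  cases hx with
  | p n hn =>
    have hne : n ≠ k := fun e => hxp (e ▸ rfl)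
    refine hp (.p (k - n)) ?_ ?_ <;> simp only [path]
    · rw [H.e₁_mul_p_pow_comm, mul_assoc, ← mul_assoc e₁, H.idem1, H.e₁_mul_p_pow_comm,
        ← mul_assoc, ← pow_add, Nat.sub_add_cancel hn, H.p_pow_mul_e₁ hk]
    · rw [mul_assoc, H.p_pow_mul_p_pow_k (by omega), mul_zero]
  | pa n hn =>
    refine hp (.qbg (k - 1 - n)) ?_ ?_ <;> simp only [path]
    · rw [mul_assoc, ← mul_assoc (b * g), H.bg_mul_p_pow, mul_assoc, ← mul_assoc, ← pow_add,
        Nat.sub_add_cancel (by omega), ← H.q_pow_k, H.q_pow_k_eq]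
    · rw [mul_assoc, mul_assoc, H.g_mul_p_pow_k, mul_zero, mul_zero]
  | q n h1 hn =>
    refine hp (.q (k - n)) ?_ ?_ <;> simp only [path]
    · rw [← pow_add, Nat.sub_add_cancel hn.le, H.q_pow_k_eq]
    · rw [← H.q_pow_k_eq, ← pow_add, H.q_pow_eq_zero (by omega)]
  | qbg n hn =>
    refine hp (.pa (k - 1 - n)) ?_ ?_ <;> simp only [path]
    · rw [mul_assoc, ← mul_assoc a, H.a_mul_q_pow, mul_assoc, ← mul_assoc, ← pow_add,
        Nat.sub_add_cancel (by omega), ← mul_assoc a, ← H.p_pow_k]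
    · rw [mul_assoc, H.a_mul_p_pow hk, mul_zero]
  | qb n hn =>
    refine hh (.rga (k - 1 - n)) ?_ ?_ <;> simp only [path]
    · rw [mul_assoc, ← mul_assoc (g * a), H.ga_mul_q_pow, mul_assoc, ← mul_assoc, ← pow_add,
        Nat.sub_add_cancel (by omega), ← H.r_pow_k, H.r_pow_k_eq]
    · rw [mul_assoc, mul_assoc, H.a_mul_h_pow_t, mul_zero, mul_zero]
  | pab n hn =>
    refine hh (.rg (k - 1 - n)) ?_ ?_ <;> simp only [path]
    · rw [mul_assoc, ← mul_assoc g, H.g_mul_p_pow, mul_assoc, ← mul_assoc, ← pow_add,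
        Nat.sub_add_cancel (by omega), ← mul_assoc g, ← H.r_pow_k, H.r_pow_k_eq]
    · rw [mul_assoc, H.g_mul_h_pow_t, mul_zero]
  | rg n hn =>
    refine hp (.pab (k - 1 - n)) ?_ ?_ <;> simp only [path]
    · rw [mul_assoc, ← mul_assoc (a * b), H.ab_mul_r_pow, mul_assoc, ← mul_assoc, ← pow_add,
        Nat.sub_add_cancel (by omega), ← H.p_pow_k]
    · rw [mul_assoc, mul_assoc, H.b_mul_p_pow_k, mul_zero, mul_zero]
  | rga n hn =>
    refine hp (.qb (k - 1 - n)) ?_ ?_ <;> simp only [path]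
    · rw [mul_assoc, ← mul_assoc b, H.b_mul_r_pow, mul_assoc, ← mul_assoc, ← pow_add,
        Nat.sub_add_cancel (by omega), ← mul_assoc b, ← H.q_pow_k, H.q_pow_k_eq]
    · rw [mul_assoc, H.b_mul_p_pow_k, mul_zero]
  | r n h1 hn =>
    refine hh (.r (k - n)) ?_ ?_ <;> simp only [path]
    · rw [← pow_add, Nat.sub_add_cancel hn.le, H.r_pow_k_eq]
    · rw [← H.r_pow_k_eq, ← pow_add, H.r_pow_eq_zero (by omega)]
  | h n hn =>
    have hne : n ≠ t := fun e => hxh (e ▸ rfl)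
    refine hh (.h (t - n)) ?_ ?_ <;> simp only [path]
    · rw [H.e₂_mul_h_pow_comm, mul_assoc, ← mul_assoc e₂, H.idem2, H.e₂_mul_h_pow_comm,
        ← mul_assoc, ← pow_add, Nat.sub_add_cancel hn, ← H.e₂_mul_h_pow_comm,
        H.e₂_mul_h_pow (by omega)]
    · rw [mul_assoc, ← pow_add, H.h_pow_eq_zero (by omega), mul_zero]

end Socle

end IsSemidihedral

section Presentation

theorem mk_eq_of_rel {x y : FreeAlgebra F Gen} (hxy : Rel F k t c x y) :
    mk F k t c x = mk F k t c y :=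
  RingQuot.mkAlgHom_rel F hxy

theorem adjoin_generators_eq_top :
    Algebra.adjoin F {E1 F k t c, E2 F k t c, Al F k t c, Be F k t c, Ga F k t c, Et F k t c} =
      ⊤ := by
  refine top_unique fun x _ => ?_
  obtain ⟨y, rfl⟩ : ∃ y, mk F k t c y = x := RingQuot.mkAlgHom_surjective F (Rel F k t c) x
  induction y using FreeAlgebra.induction with
  | grade0 z => rw [AlgHom.commutes]; exact Subalgebra.algebraMap_mem _ z
  | grade1 u => refine Algebra.subset_adjoin ?_; cases u <;> simp [E1, E2, Al, Be, Ga, Et, gen]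
  | mul y z hy hz =>
    rw [map_mul]
    exact mul_mem (hy (Algebra.mem_top)) (hz (Algebra.mem_top))
  | add y z hy hz =>
    rw [map_add]
    exact add_mem (hy (Algebra.mem_top)) (hz (Algebra.mem_top))

theorem isSemidihedral (hk : 1 ≤ k) (ht : 2 ≤ t) (hkt : 4 ≤ k + t) :
    IsSemidihedral k t c (E1 F k t c) (E2 F k t c) (Al F k t c) (Be F k t c) (Ga F k t c)
      (Et F k t c) (ABG F k t c) (BGA F k t c) (GAB F k t c) where
  one_le := hk
  two_le := ht
  four_le := hkt
  p_eq := rfl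
  q_eq := rfl
  r_eq := rfl
  unit := by simpa only [E1, E2, map_add, map_one] using mk_eq_of_rel F k t c .unit
  idem1 := by simpa only [E1, map_mul] using mk_eq_of_rel F k t c .idem1
  idem2 := by simpa only [E2, map_mul] using mk_eq_of_rel F k t c .idem2
  orth12 := by simpa only [E1, E2, map_mul, map_zero] using mk_eq_of_rel F k t c .orth12
  orth21 := by simpa only [E1, E2, map_mul, map_zero] using mk_eq_of_rel F k t c .orth21
  aL := by simpa only [E1, Al, map_mul] using mk_eq_of_rel F k t c .aL
  aR := by simpa only [E1, Al, map_mul] using mk_eq_of_rel F k t c .aR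
  bL := by simpa only [E1, Be, map_mul] using mk_eq_of_rel F k t c .bL
  bR := by simpa only [E2, Be, map_mul] using mk_eq_of_rel F k t c .bR
  gL := by simpa only [E2, Ga, map_mul] using mk_eq_of_rel F k t c .gL
  gR := by simpa only [E1, Ga, map_mul] using mk_eq_of_rel F k t c .gR
  hL := by simpa only [E2, Et, map_mul] using mk_eq_of_rel F k t c .hL
  hR := by simpa only [E2, Et, map_mul] using mk_eq_of_rel F k t c .hR
  bh := by simpa only [Be, Et, ABG, Al, Ga, map_mul, map_pow] using mk_eq_of_rel F k t c .bh
  gb := by simpa only [Ga, Be, Et, map_mul, map_pow] using mk_eq_of_rel F k t c .gb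
  hg := by simpa only [Et, Ga, GAB, Al, Be, map_mul, map_pow] using mk_eq_of_rel F k t c .hg
  bhh := by simpa only [Be, Et, map_mul, map_zero] using mk_eq_of_rel F k t c .bh2
  hhg := by simpa only [Et, Ga, map_mul, map_zero] using mk_eq_of_rel F k t c .h2g
  asq := by simpa only [ABG, Al, Be, Ga, map_mul, map_pow, map_smul] using mk_eq_of_rel F k t c .asq
  adjoin := adjoin_generators_eq_top F k t c

theorem path_mem_BB (hk : 1 ≤ k) (ht : 2 ≤ t) (hkt : 4 ≤ k + t) {i j : Vertex} {x : PathIdx}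
    (hx : IsPath k t i j x) :
    PathIdx.path (E1 F k t c) (E2 F k t c) (Al F k t c) (Be F k t c) (Ga F k t c) (Et F k t c)
      (ABG F k t c) (BGA F k t c) (GAB F k t c) x ∈ BB F k t c := by
  have H := isSemidihedral F k t c hk ht hkt
  cases hx with
  | p n hn =>
    refine .inl (.inl (.inl ?_))
    rcases Nat.eq_zero_or_pos n with rfl | h1
    · exact .inl (.inl (.inl (.inl (by simp [PathIdx.path]))))
    · rw [PathIdx.path, H.e₁_mul_p_pow h1]
      rcases hn.eq_or_lt with rfl | hn
      · exact .inl (.inl (.inl (.inl (by simp))))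
      · exact .inl (.inl (.inl (.inr ⟨n, ⟨h1, by omega⟩, rfl⟩)))
  | pa n hn =>
    refine .inl (.inl (.inl ?_))
    rcases Nat.eq_zero_or_pos n with rfl | h1
    · exact .inl (.inl (.inl (.inl (by simp [PathIdx.path]))))
    · exact .inl (.inl (.inr ⟨n, ⟨h1, by omega⟩, rfl⟩))
  | q n h1 hn => exact .inl (.inl (.inl (.inl (.inr ⟨n, ⟨h1, by omega⟩, rfl⟩))))
  | qbg n hn =>
    refine .inl (.inl (.inl ?_))
    rcases Nat.eq_zero_or_pos n with rfl | h1
    · exact .inl (.inl (.inl (.inl (by simp [PathIdx.path]))))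
    · exact .inr ⟨n, ⟨h1, by omega⟩, rfl⟩
  | qb n hn =>
    refine .inl (.inl (.inr ?_))
    rcases Nat.eq_zero_or_pos n with rfl | h1
    · exact .inl (.inl (by simp [PathIdx.path]))
    · exact .inl (.inr ⟨n, ⟨h1, by omega⟩, rfl⟩)
  | pab n hn =>
    refine .inl (.inl (.inr ?_))
    rcases Nat.eq_zero_or_pos n with rfl | h1
    · exact .inl (.inl (by simp [PathIdx.path]))
    · exact .inr ⟨n, ⟨h1, by omega⟩, rfl⟩
  | rg n hn =>
    refine .inl (.inr ?_)
    rcases Nat.eq_zero_or_pos n with rfl | h1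
    · exact .inl (.inl (by simp [PathIdx.path]))
    · exact .inl (.inr ⟨n, ⟨h1, by omega⟩, rfl⟩)
  | rga n hn =>
    refine .inl (.inr ?_)
    rcases Nat.eq_zero_or_pos n with rfl | h1
    · exact .inl (.inl (by simp [PathIdx.path]))
    · exact .inr ⟨n, ⟨h1, by omega⟩, rfl⟩
  | r n h1 hn => exact .inr (.inl (.inr ⟨n, ⟨h1, by omega⟩, rfl⟩))
  | h n hn =>
    refine .inr ?_
    rcases Nat.eq_zero_or_pos n with rfl | h1
    · exact .inl (.inl (by simp [PathIdx.path]))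
    · rw [PathIdx.path, H.e₂_mul_h_pow h1]
      exact .inr ⟨n, ⟨h1, hn⟩, rfl⟩

end Presentation

/-- **Proposition (symmetrizing form, semidihedral type, second family).**
For `k ≥ 1`, `t ≥ 2` with `k + t ≥ 4` and `c ∈ {0,1}` the bilinear form
`⟨x, y⟩ = ψ(xy)` on `B^{k,t}_c` is associative, symmetric and non-degenerate;
in particular `B^{k,t}_c` is a symmetric F-algebra. -/
theorem semidihedral_two_form_symmetric_nondegenerate
    (F : Type) [Field F] [IsAlgClosed F] [CharP F 2]
    (k t : ℕ) (hk : 1 ≤ k) (ht : 2 ≤ t) (hkt : 4 ≤ k + t) (c : F) (hc : c = 0 ∨ c = 1)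
    (ψ : BA F k t c →ₗ[F] F) (hψ : SoclePsi F k t c ψ) :
    (∀ x y z : BA F k t c, ψ ((x * y) * z) = ψ (x * (y * z))) ∧
    (∀ x y : BA F k t c, ψ (x * y) = ψ (y * x)) ∧
    (∀ x : BA F k t c, (∀ y : BA F k t c, ψ (x * y) = 0) → x = 0) ∧
    (∃ φ : BA F k t c →ₗ[F] F,
      (∀ x y : BA F k t c, φ (x * y) = φ (y * x)) ∧
      (∀ x : BA F k t c, (∀ y : BA F k t c, φ (x * y) = 0) → x = 0)) := by
  have H := isSemidihedral F k t c hk ht hkt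
  have Hψ := H.isSocleForm fun _ _ _ hx => hψ _ (path_mem_BB F k t c hk ht hkt hx)
  have hsymm := H.form_mul_comm Hψ
  have hnondeg := H.eq_zero_of_form_mul_eq_zero Hψ
  exact ⟨fun x y z => by rw [mul_assoc], hsymm, hnondeg, ψ, hsymm, hnondeg⟩

end SD2Paper

end
end

section
/- For all integers k,s ≥ 1, c ∈ {0,1} and every n ≥ 0, the socle of A^{k,s}_c is contained in the generalized Reynolds ideal Tₙ(A^{k,s}_c)^⊥; in particular soc(A^{k,s}_c) is contained in the center Z(A^{k,s}_c). -/
/- Common setup: the algebras D(2B)^{k,s}(c) of dihedral type, over a field F,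
   presented as a quotient of the free algebra on the paths-generators
   e₁, e₂ (trivial paths), α (loop at vertex 1), β (arrow 1 → 2),
   γ (arrow 2 → 1), η (loop at vertex 2), by the path-algebra relations
   together with Erdmann's relations
   βη = 0, ηγ = 0, γβ = 0, α² = c(αβγ)^k, (αβγ)^k = (βγα)^k, η^s = (γαβ)^k. -/

noncomputable section

namespace DihedralPaper

inductive Gen : Type
  | e1 | e2 | a | b | g | h

variable (F : Type) [Field F]

/-- The generators inside the free algebra. -/
def gen (t : Gen) : FreeAlgebra F Gen := FreeAlgebra.ι F t

/-- The defining relations of `D(2B)^{k,s}(c)` (paths written from left to right). -/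
inductive Rel (k s : ℕ) (c : F) : FreeAlgebra F Gen → FreeAlgebra F Gen → Prop
  | unit : Rel k s c (gen F .e1 + gen F .e2) 1
  | idem1 : Rel k s c (gen F .e1 * gen F .e1) (gen F .e1)
  | idem2 : Rel k s c (gen F .e2 * gen F .e2) (gen F .e2)
  | orth12 : Rel k s c (gen F .e1 * gen F .e2) 0
  | orth21 : Rel k s c (gen F .e2 * gen F .e1) 0
  | aL : Rel k s c (gen F .e1 * gen F .a) (gen F .a)
  | aR : Rel k s c (gen F .a * gen F .e1) (gen F .a)
  | bL : Rel k s c (gen F .e1 * gen F .b) (gen F .b)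
  | bR : Rel k s c (gen F .b * gen F .e2) (gen F .b)
  | gL : Rel k s c (gen F .e2 * gen F .g) (gen F .g)
  | gR : Rel k s c (gen F .g * gen F .e1) (gen F .g)
  | hL : Rel k s c (gen F .e2 * gen F .h) (gen F .h)
  | hR : Rel k s c (gen F .h * gen F .e2) (gen F .h)
  | bh : Rel k s c (gen F .b * gen F .h) 0
  | hg : Rel k s c (gen F .h * gen F .g) 0
  | gb : Rel k s c (gen F .g * gen F .b) 0
  | asq : Rel k s c (gen F .a * gen F .a) (c • (gen F .a * gen F .b * gen F .g) ^ k)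
  | abg : Rel k s c ((gen F .a * gen F .b * gen F .g) ^ k) ((gen F .b * gen F .g * gen F .a) ^ k)
  | hs : Rel k s c ((gen F .h) ^ s) ((gen F .g * gen F .a * gen F .b) ^ k)

/-- The algebra `A^{k,s}_c = D(2B)^{k,s}(c)`. -/
def DA (k s : ℕ) (c : F) : Type := RingQuot (Rel F k s c)

instance (k s : ℕ) (c : F) : Ring (DA F k s c) :=
  inferInstanceAs (Ring (RingQuot (Rel F k s c)))

instance (k s : ℕ) (c : F) : Algebra F (DA F k s c) :=
  inferInstanceAs (Algebra F (RingQuot (Rel F k s c)))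

variable (k s : ℕ) (c : F)

/-- The canonical projection. -/
def mk : FreeAlgebra F Gen →ₐ[F] DA F k s c := RingQuot.mkAlgHom F (Rel F k s c)

def E1 : DA F k s c := mk F k s c (gen F .e1)
def E2 : DA F k s c := mk F k s c (gen F .e2)
/-- The image of the loop α at vertex 1. -/
def Al : DA F k s c := mk F k s c (gen F .a)
/-- The image of the arrow β : 1 → 2. -/
def Be : DA F k s c := mk F k s c (gen F .b)
/-- The image of the arrow γ : 2 → 1. -/
def Ga : DA F k s c := mk F k s c (gen F .g)
/-- The image of the loop η at vertex 2. -/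
def Et : DA F k s c := mk F k s c (gen F .h)

/-- The path αβγ. -/
def ABG : DA F k s c := Al F k s c * Be F k s c * Ga F k s c
/-- The path βγα. -/
def BGA : DA F k s c := Be F k s c * Ga F k s c * Al F k s c
/-- The path γαβ. -/
def GAB : DA F k s c := Ga F k s c * Al F k s c * Be F k s c

/-- The standard basis paths 𝓑₁₁ of e₁Ae₁. -/
def B11 : Set (DA F k s c) :=
  {E1 F k s c, Al F k s c, Be F k s c * Ga F k s c, (ABG F k s c) ^ k}
    ∪ (fun i => (ABG F k s c) ^ i) '' Set.Icc 1 (k - 1)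
    ∪ (fun i => (ABG F k s c) ^ i * Al F k s c) '' Set.Icc 1 (k - 1)
    ∪ (fun i => (BGA F k s c) ^ i) '' Set.Icc 1 (k - 1)
    ∪ (fun i => (BGA F k s c) ^ i * (Be F k s c * Ga F k s c)) '' Set.Icc 1 (k - 1)

/-- The standard basis paths 𝓑₁₂ of e₁Ae₂. -/
def B12 : Set (DA F k s c) :=
  {Be F k s c, Al F k s c * Be F k s c}
    ∪ (fun i => (BGA F k s c) ^ i * Be F k s c) '' Set.Icc 1 (k - 1)
    ∪ (fun i => (ABG F k s c) ^ i * (Al F k s c * Be F k s c)) '' Set.Icc 1 (k - 1)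

/-- The standard basis paths 𝓑₂₁ of e₂Ae₁. -/
def B21 : Set (DA F k s c) :=
  {Ga F k s c, Ga F k s c * Al F k s c}
    ∪ (fun i => (GAB F k s c) ^ i * Ga F k s c) '' Set.Icc 1 (k - 1)
    ∪ (fun i => (GAB F k s c) ^ i * (Ga F k s c * Al F k s c)) '' Set.Icc 1 (k - 1)

/-- The standard basis paths 𝓑₂₂ of e₂Ae₂. -/
def B22 : Set (DA F k s c) :=
  {E2 F k s c}
    ∪ (fun i => (GAB F k s c) ^ i) '' Set.Icc 1 (k - 1)
    ∪ (fun j => (Et F k s c) ^ j) '' Set.Icc 1 s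

/-- The standard path basis 𝓑 of `A^{k,s}_c`. -/
def BB : Set (DA F k s c) :=
  B11 F k s c ∪ B12 F k s c ∪ B21 F k s c ∪ B22 F k s c

/-- The commutator subspace K(A): the F-linear span of all commutators. -/
def Kspan (A : Type) [Ring A] [Algebra F A] : Submodule F A :=
  Submodule.span F {z : A | ∃ u v : A, z = u * v - v * u}

/-- The (left) socle of a ring: the sum of all simple (left) submodules. -/
def socle (A : Type) [Ring A] : Submodule A A := sSup {S : Submodule A A | IsAtom S}

/-- `ψ` is the linear form sending each standard basis path lying in the socle to 1
    and every other standard basis path to 0. -/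
def SoclePsi (ψ : DA F k s c →ₗ[F] F) : Prop :=
  ∀ p ∈ BB F k s c,
    (p ∈ socle (DA F k s c) → ψ p = 1) ∧ (p ∉ socle (DA F k s c) → ψ p = 0)

/-- `T₁(A) = {x : x² ∈ K(A)}`. -/
def T1set : Set (DA F k s c) := {z | z ^ 2 ∈ Kspan F (DA F k s c)}

/-- The orthogonal space `T₁(A)^⊥` with respect to the form `⟨x, y⟩ = ψ(xy)`. -/
def T1perp (ψ : DA F k s c →ₗ[F] F) : Set (DA F k s c) :=
  {y | ∀ x ∈ T1set F k s c, ψ (y * x) = 0}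

/-- The first generalized Reynolds ideal, as an ideal of the center `Z(A)`. -/
def ReynoldsIdeal (ψ : DA F k s c →ₗ[F] F) :
    Ideal (Subalgebra.center F (DA F k s c)) :=
  Ideal.span {z : Subalgebra.center F (DA F k s c) | (z : DA F k s c) ∈ T1perp F k s c ψ}


section Relations

theorem mk_eq_of_rel {x y : FreeAlgebra F Gen} (h : Rel F k s c x y) :
    mk F k s c x = mk F k s c y :=
  RingQuot.mkAlgHom_rel F h

theorem mk_mul_mk_of_rel {x y z : FreeAlgebra F Gen} (h : Rel F k s c (x * y) z) :
    mk F k s c x * mk F k s c y = mk F k s c z := by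
  rw [← map_mul, mk_eq_of_rel F k s c h]

/-- The arrows `α`, `γ`, `β`, indexed so that `arr (j + 1) * arr j` is a path of length two. -/
def arr (j : ZMod 3) : DA F k s c :=
  (![Al F k s c, Ga F k s c, Be F k s c] : Fin 3 → DA F k s c) j

local notation "δ" => arr F k s c
local notation "η" => Et F k s c
local notation "ε₁" => E1 F k s c
local notation "ε₂" => E2 F k s c

theorem zmod_three_cases (j : ZMod 3) : j = 0 ∨ j = 1 ∨ j = 2 := by
  revert j; decide

theorem E1_add_E2 : ε₁ + ε₂ = 1 := by
  have h := mk_eq_of_rel F k s c Rel.unit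
  rwa [map_add, map_one] at h

theorem E1_mul_E1 : ε₁ * ε₁ = ε₁ :=
  mk_mul_mk_of_rel F k s c Rel.idem1

theorem E1_mul_E2 : ε₁ * ε₂ = 0 :=
  (mk_mul_mk_of_rel F k s c Rel.orth12).trans (map_zero _)

theorem E2_mul_E1 : ε₂ * ε₁ = 0 :=
  (mk_mul_mk_of_rel F k s c Rel.orth21).trans (map_zero _)

theorem E1_mul_arr_zero : ε₁ * δ 0 = δ 0 :=
  mk_mul_mk_of_rel F k s c Rel.aL

theorem arr_zero_mul_E1 : δ 0 * ε₁ = δ 0 :=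
  mk_mul_mk_of_rel F k s c Rel.aR

theorem E1_mul_arr_two : ε₁ * δ 2 = δ 2 :=
  mk_mul_mk_of_rel F k s c Rel.bL

theorem arr_two_mul_E2 : δ 2 * ε₂ = δ 2 :=
  mk_mul_mk_of_rel F k s c Rel.bR

theorem E2_mul_arr_one : ε₂ * δ 1 = δ 1 :=
  mk_mul_mk_of_rel F k s c Rel.gL

theorem arr_one_mul_E1 : δ 1 * ε₁ = δ 1 :=
  mk_mul_mk_of_rel F k s c Rel.gR

theorem E2_mul_Et : ε₂ * η = η :=
  mk_mul_mk_of_rel F k s c Rel.hL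

theorem Et_mul_E2 : η * ε₂ = η :=
  mk_mul_mk_of_rel F k s c Rel.hR

theorem E1_mul_arr_one : ε₁ * δ 1 = 0 := by
  rw [← E2_mul_arr_one, ← mul_assoc, E1_mul_E2, zero_mul]

theorem E2_mul_arr_zero : ε₂ * δ 0 = 0 := by
  rw [← E1_mul_arr_zero, ← mul_assoc, E2_mul_E1, zero_mul]

theorem E2_mul_arr_two : ε₂ * δ 2 = 0 := by
  rw [← E1_mul_arr_two, ← mul_assoc, E2_mul_E1, zero_mul]

theorem E1_mul_Et : ε₁ * η = 0 := by
  rw [← E2_mul_Et, ← mul_assoc, E1_mul_E2, zero_mul]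

theorem arr_zero_mul_E2 : δ 0 * ε₂ = 0 := by
  rw [← arr_zero_mul_E1, mul_assoc, E1_mul_E2, mul_zero]

theorem arr_one_mul_E2 : δ 1 * ε₂ = 0 := by
  rw [← arr_one_mul_E1, mul_assoc, E1_mul_E2, mul_zero]

theorem arr_two_mul_E1 : δ 2 * ε₁ = 0 := by
  rw [← arr_two_mul_E2, mul_assoc, E2_mul_E1, mul_zero]

theorem Et_mul_E1 : η * ε₁ = 0 := by
  rw [← Et_mul_E2, mul_assoc, E2_mul_E1, mul_zero]

theorem Et_mul_arr (j : ZMod 3) : η * δ j = 0 := by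
  rcases zmod_three_cases j with rfl | rfl | rfl
  · rw [← Et_mul_E2, mul_assoc, E2_mul_arr_zero, mul_zero]
  · exact (mk_mul_mk_of_rel F k s c Rel.hg).trans (map_zero _)
  · rw [← Et_mul_E2, mul_assoc, E2_mul_arr_two, mul_zero]

theorem arr_mul_Et (j : ZMod 3) : δ j * η = 0 := by
  rcases zmod_three_cases j with rfl | rfl | rfl
  · rw [← E2_mul_Et, ← mul_assoc, arr_zero_mul_E2, zero_mul]
  · rw [← E2_mul_Et, ← mul_assoc, arr_one_mul_E2, zero_mul]
  · exact (mk_mul_mk_of_rel F k s c Rel.bh).trans (map_zero _)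

/-- The path of length `m + 1` along the oriented cycle `αβγ` whose last arrow is `arr i`. -/
def cyc (i : ZMod 3) : ℕ → DA F k s c
  | 0 => δ i
  | m + 1 => δ (i + m + 1) * cyc i m

local notation "π" => cyc F k s c

theorem cyc_zero (i : ZMod 3) : π i 0 = δ i := rfl

theorem cyc_succ (i : ZMod 3) (m : ℕ) : π i (m + 1) = δ (i + m + 1) * π i m := rfl

theorem cyc_three_mul_add_two (i : ZMod 3) (r : ℕ) :
    π i (3 * r + 2) = (δ (i + 2) * δ (i + 1) * δ i) ^ (r + 1) := by
  have h3 : (3 : ZMod 3) = 0 := rfl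
  have hstep (m : ℕ) : π i (3 * m + 2) = δ (i + 2) * δ (i + 1) * π i (3 * m) := by
    rw [cyc_succ, cyc_succ, mul_assoc]
    congr 2
    · push_cast; rw [h3]; ring_nf
    · push_cast; rw [h3]; ring_nf
  induction r with
  | zero => rw [hstep, mul_zero, cyc_zero, zero_add, pow_one]
  | succ r ih =>
    rw [hstep, show 3 * (r + 1) = 3 * r + 2 + 1 by ring, cyc_succ, ih, pow_succ' _ (r + 1),
      mul_assoc _ (δ i)]
    congr 3
    push_cast; rw [h3]
    linear_combination h3

variable {k} in
theorem cyc_last (hk : 1 ≤ k) (i : ZMod 3) :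
    π i (3 * k - 1) = (δ (i + 2) * δ (i + 1) * δ i) ^ k := by
  obtain ⟨r, rfl⟩ := Nat.exists_eq_add_of_le' hk
  exact cyc_three_mul_add_two F (r + 1) s c i r

theorem E1_mul_cyc (i : ZMod 3) (m : ℕ) : ε₁ * π i m = if i + m = 1 then 0 else π i m := by
  have h (j : ZMod 3) : ε₁ * δ j = if j = 1 then 0 else δ j := by
    rcases zmod_three_cases j with rfl | rfl | rfl
    · exact E1_mul_arr_zero F k s c
    · exact E1_mul_arr_one F k s c
    · exact E1_mul_arr_two F k s c
  cases m with
  | zero => simp [cyc_zero, h]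
  | succ m =>
    rw [cyc_succ, ← mul_assoc, h]
    simp only [Nat.cast_succ, add_assoc]
    split_ifs <;> simp

theorem Et_mul_cyc (i : ZMod 3) (m : ℕ) : η * π i m = 0 := by
  cases m with
  | zero => exact Et_mul_arr F k s c i
  | succ m => rw [cyc_succ, ← mul_assoc, Et_mul_arr, zero_mul]

theorem arr_mul_pow_Et (j : ZMod 3) (m : ℕ) : δ j * η ^ (m + 1) = 0 := by
  rw [pow_succ', ← mul_assoc, arr_mul_Et, zero_mul]

theorem pow_Et_mul_arr (j : ZMod 3) (m : ℕ) : η ^ (m + 1) * δ j = 0 := by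
  rw [pow_succ, mul_assoc, Et_mul_arr, mul_zero]

variable {k s}

theorem cyc_last_one (hk : 1 ≤ k) : π 1 (3 * k - 1) = ABG F k s c ^ k := cyc_last F s c hk 1

theorem cyc_last_zero (hk : 1 ≤ k) : π 0 (3 * k - 1) = ABG F k s c ^ k := by
  have h := mk_eq_of_rel F k s c Rel.abg
  simp only [map_pow, map_mul] at h
  exact (cyc_last F s c hk 0).trans h.symm

theorem cyc_last_two (hk : 1 ≤ k) : π 2 (3 * k - 1) = η ^ s := by
  have h := mk_eq_of_rel F k s c Rel.hs
  simp only [map_pow, map_mul] at h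
  exact (cyc_last F s c hk 2).trans h.symm

theorem arr_zero_sq : δ 0 * δ 0 = c • ABG F k s c ^ k := by
  have h := mk_eq_of_rel F k s c Rel.asq
  rwa [map_mul, map_smul, map_pow, map_mul, map_mul] at h

theorem arr_mul_arr (j i : ZMod 3) (h : j ≠ i + 1) :
    δ j * δ i = if j = 0 ∧ i = 0 then c • ABG F k s c ^ k else 0 := by
  rcases zmod_three_cases j with rfl | rfl | rfl <;>
    rcases zmod_three_cases i with rfl | rfl | rfl
  · exact arr_zero_sq F c
  · change δ 0 * δ 1 = 0
    rw [← E2_mul_arr_one, ← mul_assoc, arr_zero_mul_E2, zero_mul]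
  · exact absurd rfl h
  · exact absurd rfl h
  · change δ 1 * δ 1 = 0
    nth_rw 2 [← E2_mul_arr_one]
    rw [← mul_assoc, arr_one_mul_E2, zero_mul]
  · change δ 1 * δ 2 = 0
    exact (mk_mul_mk_of_rel F k s c Rel.gb).trans (map_zero _)
  · change δ 2 * δ 0 = 0
    rw [← E1_mul_arr_zero, ← mul_assoc, arr_two_mul_E1, zero_mul]
  · exact absurd rfl h
  · change δ 2 * δ 2 = 0
    nth_rw 2 [← E1_mul_arr_two]
    rw [← mul_assoc, arr_two_mul_E1, zero_mul]

theorem ABG_pow_eq (hk : 1 ≤ k) : ABG F k s c ^ k = (δ 2 * δ 1 * δ 0) ^ k := by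
  rw [← cyc_last_zero F c hk, cyc_last F s c hk]; rfl

theorem ABG_pow_mul_arr (hk : 1 ≤ k) (j : ZMod 3) : ABG F k s c ^ k * δ j = 0 := by
  have hABG : ABG F k s c = δ 0 * δ 2 * δ 1 := rfl
  have hk0 : k ≠ 0 := by omega
  have h2 : ABG F k s c ^ k * δ 2 = 0 := by
    rw [← pow_sub_one_mul hk0, hABG, mul_assoc, mul_assoc _ (δ 1), arr_mul_arr F c 1 2 (by decide)]
    simp
  rcases zmod_three_cases j with rfl | rfl | rfl
  · have hcomm (m : ℕ) :
        (δ 0 * δ 2 * δ 1) ^ m * δ 0 = δ 0 * (δ 2 * δ 1 * δ 0) ^ m := by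
      induction m with
      | zero => simp
      | succ m ih => rw [pow_succ', mul_assoc, ih, pow_succ']; simp only [mul_assoc]
    have h := hcomm k
    rw [← ABG_pow_eq F c hk, ← hABG] at h
    rw [h, ← mul_pow_sub_one hk0, hABG]
    simp only [← mul_assoc]
    rw [arr_zero_sq, smul_mul_assoc, h2]
    simp
  · rw [ABG_pow_eq F c hk, ← pow_sub_one_mul hk0, mul_assoc, mul_assoc _ (δ 0),
      arr_mul_arr F c 0 1 (by decide)]
    simp
  · exact h2

theorem arr_mul_ABG_pow (hk : 1 ≤ k) (j : ZMod 3) : δ j * ABG F k s c ^ k = 0 := by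
  have hABG : ABG F k s c = δ 0 * δ 2 * δ 1 := rfl
  have hk0 : k ≠ 0 := by omega
  rcases zmod_three_cases j with rfl | rfl | rfl
  · rw [← mul_pow_sub_one hk0, hABG]
    simp only [← mul_assoc]
    rw [arr_zero_sq, smul_mul_assoc, ABG_pow_mul_arr F c hk]
    simp
  · rw [ABG_pow_eq F c hk, ← mul_pow_sub_one hk0]
    simp only [← mul_assoc]
    rw [arr_mul_arr F c 1 2 (by decide)]
    simp
  · rw [← mul_pow_sub_one hk0, hABG]
    simp only [← mul_assoc]
    rw [arr_mul_arr F c 2 0 (by decide)]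
    simp [show (2 : ZMod 3) ≠ 0 by decide]

theorem arr_mul_cyc_of_ne (hk : 1 ≤ k) (j i : ZMod 3) (m : ℕ) (h : j ≠ i + m + 1) :
    δ j * π i m = if j = 0 ∧ i = 0 ∧ m = 0 then c • ABG F k s c ^ k else 0 := by
  cases m with
  | zero => simpa [cyc_zero] using arr_mul_arr F c j i (by simpa using h)
  | succ m =>
    have hu : ABG F k s c ^ k * π i m = 0 := by
      cases m with
      | zero => exact ABG_pow_mul_arr F c hk i
      | succ m => rw [cyc_succ, ← mul_assoc, ABG_pow_mul_arr F c hk, zero_mul]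
    rw [cyc_succ, ← mul_assoc, arr_mul_arr F c j _ (by simpa [add_assoc] using h)]
    split_ifs <;> simp_all

theorem cyc_eq_zero (hk : 1 ≤ k) (hs : 1 ≤ s) (i : ZMod 3) (m : ℕ) (hm : 3 * k ≤ m) :
    π i m = 0 := by
  induction m, hm using Nat.le_induction with
  | base =>
    obtain ⟨r, hr⟩ : ∃ r, 3 * k = r + 1 := ⟨3 * k - 1, by omega⟩
    have hr' : r = 3 * k - 1 := by omega
    rw [hr, cyc_succ, hr']
    rcases zmod_three_cases i with rfl | rfl | rfl
    · rw [cyc_last_zero F c hk, arr_mul_ABG_pow F c hk]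
    · rw [cyc_last_one F c hk, arr_mul_ABG_pow F c hk]
    · obtain ⟨t, rfl⟩ := Nat.exists_eq_add_of_le' hs
      rw [cyc_last_two F c hk, arr_mul_pow_Et]
  | succ m _ ih => rw [cyc_succ, ih, mul_zero]

theorem pow_Et_eq_zero (hk : 1 ≤ k) (m : ℕ) (hm : s ≤ m) : η ^ (m + 1) = 0 := by
  rw [show m + 1 = (m - s) + 1 + s by omega, pow_add, ← cyc_last_two F c hk, pow_succ, mul_assoc,
    Et_mul_cyc, mul_zero]

variable (k s) in
theorem mem_subalgebra_of_generators_mem (S : Subalgebra F (DA F k s c)) (h1 : ε₁ ∈ S) (h2 : ε₂ ∈ S)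
    (hδ : ∀ j, δ j ∈ S) (hη : η ∈ S) (x : DA F k s c) : x ∈ S := by
  obtain ⟨w, rfl⟩ := RingQuot.mkAlgHom_surjective F (Rel F k s c) x
  change mk F k s c w ∈ S
  induction w using FreeAlgebra.induction with
  | grade0 r => rw [AlgHom.commutes]; exact S.algebraMap_mem r
  | grade1 t =>
    cases t
    · exact h1
    · exact h2
    · exact hδ 0
    · exact hδ 2
    · exact hδ 1
    · exact hη
  | mul a b ha hb => rw [map_mul]; exact S.mul_mem ha hb
  | add a b ha hb => rw [map_add]; exact S.add_mem ha hb

variable (k s) in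
/-- The span of the paths along `αβγ` and along `η` that have length greater than `m`. -/
def pathFil (m : ℕ) : Submodule F (DA F k s c) :=
  Submodule.span F {x | ∃ l ≥ m, (∃ i, x = π i l) ∨ x = η ^ (l + 1)}

theorem cyc_mem_pathFil {m l : ℕ} (h : m ≤ l) (i : ZMod 3) : π i l ∈ pathFil F k s c m :=
  Submodule.subset_span ⟨l, h, .inl ⟨i, rfl⟩⟩

theorem pow_Et_mem_pathFil {m l : ℕ} (h : m ≤ l) : η ^ (l + 1) ∈ pathFil F k s c m :=
  Submodule.subset_span ⟨l, h, .inr rfl⟩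

theorem pathFil_antitone : Antitone (pathFil F k s c) := fun _ _ h =>
  Submodule.span_mono fun _ ⟨l, hl, hx⟩ => ⟨l, h.trans hl, hx⟩

theorem arr_mul_mem_pathFil (hk : 1 ≤ k) (j : ZMod 3) {m : ℕ} {x : DA F k s c}
    (hx : x ∈ pathFil F k s c m) : δ j * x ∈ pathFil F k s c (m + 1) := by
  have : pathFil F k s c m ≤ (pathFil F k s c (m + 1)).comap (LinearMap.mulLeft F (δ j)) := by
    refine Submodule.span_le.2 ?_
    rintro _ ⟨l, hl, ⟨i, rfl⟩ | rfl⟩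
    · change δ j * π i l ∈ pathFil F k s c (m + 1)
      by_cases hj : j = i + l + 1
      · rw [hj, ← cyc_succ]
        exact cyc_mem_pathFil F c (by omega) i
      · rw [arr_mul_cyc_of_ne F c hk j i l hj]
        split_ifs with h
        · rw [← cyc_last_zero F c hk]
          exact Submodule.smul_mem _ _ (cyc_mem_pathFil F c (by omega) 0)
        · exact Submodule.zero_mem _
    · change δ j * η ^ (l + 1) ∈ pathFil F k s c (m + 1)
      rw [arr_mul_pow_Et]
      exact Submodule.zero_mem _
  exact this hx

theorem Et_mul_mem_pathFil {m : ℕ} {x : DA F k s c}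
    (hx : x ∈ pathFil F k s c m) : η * x ∈ pathFil F k s c (m + 1) := by
  have : pathFil F k s c m ≤ (pathFil F k s c (m + 1)).comap (LinearMap.mulLeft F η) := by
    refine Submodule.span_le.2 ?_
    rintro _ ⟨l, hl, ⟨i, rfl⟩ | rfl⟩
    · change η * π i l ∈ pathFil F k s c (m + 1)
      rw [Et_mul_cyc]
      exact Submodule.zero_mem _
    · change η * η ^ (l + 1) ∈ pathFil F k s c (m + 1)
      rw [← pow_succ']
      exact pow_Et_mem_pathFil F c (by omega)
  exact this hx

theorem eq_zero_of_mem_pathFil (hk : 1 ≤ k) (hs : 1 ≤ s) {x : DA F k s c}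
    (hx : x ∈ pathFil F k s c (3 * k + s)) : x = 0 := by
  have : pathFil F k s c (3 * k + s) ≤ ⊥ := by
    refine Submodule.span_le.2 ?_
    rintro _ ⟨l, hl, ⟨i, rfl⟩ | rfl⟩
    · exact cyc_eq_zero F c hk hs i l (by omega)
    · exact pow_Et_eq_zero F c hk l (by omega)
  exact this hx

theorem E1_mul_mem_pathFil {x : DA F k s c}
    (hx : x ∈ pathFil F k s c 0) : ε₁ * x ∈ pathFil F k s c 0 := by
  have : pathFil F k s c 0 ≤ (pathFil F k s c 0).comap (LinearMap.mulLeft F ε₁) := by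
    refine Submodule.span_le.2 ?_
    rintro _ ⟨l, hl, ⟨i, rfl⟩ | rfl⟩
    · change ε₁ * π i l ∈ pathFil F k s c 0
      rw [E1_mul_cyc]
      split_ifs
      · exact Submodule.zero_mem _
      · exact cyc_mem_pathFil F c hl i
    · change ε₁ * η ^ (l + 1) ∈ pathFil F k s c 0
      rw [pow_succ', ← mul_assoc, E1_mul_Et, zero_mul]
      exact Submodule.zero_mem _
  exact this hx

theorem exists_eq_add_mem_pathFil (hk : 1 ≤ k) (x : DA F k s c) :
    ∃ (a b : F), ∃ v ∈ pathFil F k s c 0, x = a • ε₁ + b • ε₂ + v := by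
  set M : Submodule F (DA F k s c) := Submodule.span F {ε₁, ε₂} ⊔ pathFil F k s c 0
  have hM1 : ε₁ ∈ M := Submodule.mem_sup_left (Submodule.subset_span (by simp))
  have hM2 : ε₂ ∈ M := Submodule.mem_sup_left (Submodule.subset_span (by simp))
  have hP : pathFil F k s c 0 ≤ M := le_sup_right
  have hδM (j : ZMod 3) : δ j ∈ M := hP (cyc_mem_pathFil F c le_rfl j)
  have hηM : η ∈ M := by simpa using hP (pow_Et_mem_pathFil F c (le_refl 0))
  have hclosed (g : DA F k s c) (h1 : g * ε₁ ∈ M) (h2 : g * ε₂ ∈ M)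
      (h3 : ∀ v ∈ pathFil F k s c 0, g * v ∈ M) : ∀ y ∈ M, g * y ∈ M := by
    have : M ≤ M.comap (LinearMap.mulLeft F g) := by
      refine sup_le (Submodule.span_le.2 ?_) h3
      rintro _ (rfl | rfl)
      · exact h1
      · exact h2
    exact this
  let S : Subalgebra F (DA F k s c) :=
    { carrier := {g | ∀ y ∈ M, g * y ∈ M}
      mul_mem' := fun {g g'} hg hg' y hy => by
        rw [mul_assoc]; exact hg _ (hg' y hy)
      add_mem' := fun {g g'} hg hg' y hy => by
        rw [add_mul]; exact M.add_mem (hg y hy) (hg' y hy)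
      algebraMap_mem' := fun r y hy => by
        rw [← Algebra.smul_def]; exact M.smul_mem r hy }
  have hE1 : ε₁ ∈ S := by
    refine hclosed _ ?_ ?_ fun v hv => hP (E1_mul_mem_pathFil F c hv)
    · rwa [E1_mul_E1]
    · rw [E1_mul_E2]; exact M.zero_mem
  have hE2 : ε₂ ∈ S := by
    rw [eq_sub_of_add_eq' (E1_add_E2 F k s c)]
    exact S.sub_mem S.one_mem hE1
  have hδ (j : ZMod 3) : δ j ∈ S := by
    refine hclosed _ ?_ ?_ fun v hv => hP (pathFil_antitone F c (Nat.zero_le _)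
      (arr_mul_mem_pathFil F c hk j hv))
    · rcases zmod_three_cases j with rfl | rfl | rfl
      · rw [arr_zero_mul_E1]; exact hδM 0
      · rw [arr_one_mul_E1]; exact hδM 1
      · rw [arr_two_mul_E1]; exact M.zero_mem
    · rcases zmod_three_cases j with rfl | rfl | rfl
      · rw [arr_zero_mul_E2]; exact M.zero_mem
      · rw [arr_one_mul_E2]; exact M.zero_mem
      · rw [arr_two_mul_E2]; exact hδM 2
  have hη : η ∈ S := by
    refine hclosed _ ?_ ?_ fun v hv => hP (pathFil_antitone F c (Nat.zero_le _)
      (Et_mul_mem_pathFil F c hv))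
    · rw [Et_mul_E1]; exact M.zero_mem
    · rwa [Et_mul_E2]
  have hx : x ∈ M := by
    have h1 : (1 : DA F k s c) ∈ M := by
      rw [← E1_add_E2]; exact M.add_mem hM1 hM2
    simpa using mem_subalgebra_of_generators_mem F k s c S hE1 hE2 hδ hη x 1 h1
  obtain ⟨y, hy, v, hv, rfl⟩ := Submodule.mem_sup.1 hx
  obtain ⟨a, b, rfl⟩ := Submodule.mem_span_pair.1 hy
  exact ⟨a, b, v, hv, rfl⟩

theorem exists_coeff_of_mem_pathFil (hk : 1 ≤ k) (hs : 1 ≤ s) {v : DA F k s c}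
    (hv : v ∈ pathFil F k s c 0) :
    ∃ (p : ZMod 3 → ℕ → F) (d : ℕ → F),
      v = ∑ m ∈ Finset.range (3 * k), ∑ i, p i m • π i m +
        ∑ l ∈ Finset.range s, d l • η ^ (l + 1) := by
  induction hv using Submodule.span_induction with
  | mem x hx =>
    obtain ⟨l, -, ⟨i, rfl⟩ | rfl⟩ := hx
    · refine ⟨fun i' m => if i' = i ∧ m = l then 1 else 0, 0, ?_⟩
      simp only [ite_and, ite_smul, one_smul, zero_smul, Pi.zero_apply, Finset.sum_const_zero,
        add_zero, Finset.sum_ite_eq', Finset.mem_univ, if_true, Finset.mem_range]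
      split_ifs with h
      · rfl
      · exact cyc_eq_zero F c hk hs i l (by omega)
    · refine ⟨0, fun m => if m = l then 1 else 0, ?_⟩
      simp only [ite_smul, one_smul, zero_smul, Pi.zero_apply, Finset.sum_const_zero,
        zero_add, Finset.sum_ite_eq', Finset.mem_range]
      split_ifs with h
      · rfl
      · exact pow_Et_eq_zero F c hk l (by omega)
  | zero => exact ⟨0, 0, by simp⟩
  | add x y _ _ hx hy =>
    obtain ⟨p, d, rfl⟩ := hx
    obtain ⟨p', d', rfl⟩ := hy
    refine ⟨p + p', d + d', ?_⟩
    simp only [Pi.add_apply, add_smul, Finset.sum_add_distrib]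
    abel
  | smul r x _ hx =>
    obtain ⟨p, d, rfl⟩ := hx
    refine ⟨r • p, r • d, ?_⟩
    simp only [Pi.smul_apply, smul_eq_mul, mul_smul, Finset.smul_sum, smul_add]

theorem coeff_eq_zero_of_raising {M : Type*} [AddCommGroup M] [Module F M] (n : ℕ)
    (t : ℕ → F) (w : ℕ → M) (Q : ℕ → M →ₗ[F] M) (hQ0 : ∀ r m, n ≤ m + r → Q r (w m) = 0)
    (hQ1 : ∀ r m, m + r + 1 = n → Q r (w m) ≠ 0)
    (h : ∑ m ∈ Finset.range n, t m • w m = 0) (m : ℕ) (hm : m < n) : t m = 0 := by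
  induction m using Nat.strong_induction_on with
  | _ m ih =>
    have h' := congrArg (Q (n - 1 - m)) h
    rw [map_sum, map_zero, Finset.sum_eq_single_of_mem m (Finset.mem_range.2 hm), map_smul] at h'
    · exact (smul_eq_zero.1 h').resolve_right (hQ1 _ _ (by omega))
    · intro l hl hlm
      rcases lt_or_gt_of_ne hlm with hlt | hgt
      · rw [ih l hlt (by omega), zero_smul, map_zero]
      · rw [map_smul, hQ0 _ _ (by omega), smul_zero]

variable (k s) in
/-- The path of length `r` along the cycle `αβγ` that can be composed with `arr j` on its right. -/
def cycAfter (j : ZMod 3) : ℕ → DA F k s c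
  | 0 => 1
  | r + 1 => δ (j + r + 1) * cycAfter j r

theorem cycAfter_mul_cyc (i j : ZMod 3) (m r : ℕ) (h : i + m = j) :
    cycAfter F k s c j r * π i m = π i (m + r) := by
  induction r with
  | zero => exact one_mul _
  | succ r ih =>
    rw [cycAfter, mul_assoc, ih, ← add_assoc m r 1, cyc_succ, ← h]
    push_cast
    rw [add_assoc i]

theorem cyc_last_ne_zero (hk : 1 ≤ k) (hu : ABG F k s c ^ k ≠ 0) (hv : η ^ s ≠ 0) (i : ZMod 3) :
    π i (3 * k - 1) ≠ 0 := by
  rcases zmod_three_cases i with rfl | rfl | rfl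
  · rwa [cyc_last_zero F c hk]
  · rwa [cyc_last_one F c hk]
  · rwa [cyc_last_two F c hk]

theorem sum_arr_mul_cyc (hk : 1 ≤ k) (p : ZMod 3 → F) (j : ZMod 3) (m : ℕ) :
    δ j * ∑ i, p i • π i m = p (j - (m + 1 : ℕ)) • π (j - (m + 1 : ℕ)) (m + 1) +
      if j = 0 ∧ m = 0 then (c * p 0) • ABG F k s c ^ k else 0 := by
  have hterm (i : ZMod 3) : δ j * (p i • π i m) =
      (if i = j - (m + 1 : ℕ) then p i • π i (m + 1) else 0) +
        (if i = 0 then if j = 0 ∧ m = 0 then (c * p i) • ABG F k s c ^ k else 0 else 0) := by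
    rw [mul_smul_comm]
    by_cases hj : j = i + m + 1
    · have h1 : i = j - (m + 1 : ℕ) := by rw [hj]; push_cast; ring
      have h2 : ¬ (i = 0 ∧ j = 0 ∧ m = 0) := by
        rintro ⟨rfl, rfl, rfl⟩
        exact absurd hj (by decide)
      have h3 : (if i = 0 then if j = 0 ∧ m = 0 then (c * p i) • ABG F k s c ^ k else 0 else 0) =
          0 := by
        split_ifs with hi hjm
        exacts [absurd ⟨hi, hjm⟩ h2, rfl, rfl]
      rw [h3, add_zero, if_pos h1, hj, ← cyc_succ]
    · have h1 : ¬ i = j - (m + 1 : ℕ) := by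
        rintro rfl
        apply hj
        push_cast
        ring
      rw [if_neg h1, arr_mul_cyc_of_ne F c hk j i m hj]
      by_cases hi : i = 0
      · subst hi
        by_cases hjm : j = 0 ∧ m = 0
        · simp only [hjm, and_self, if_true, zero_add, smul_smul, mul_comm c]
        · rw [if_neg (by tauto), if_neg hjm]
          simp
      · simp [hi]
  rw [Finset.mul_sum, Finset.sum_congr rfl fun i _ => hterm i, Finset.sum_add_distrib,
    Finset.sum_ite_eq' Finset.univ, Finset.sum_ite_eq' Finset.univ]
  simp

theorem mem_center_of_commute {z : DA F k s c} (h1 : ε₁ * z = z * ε₁)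
    (hδ : ∀ j, δ j * z = 0 ∧ z * δ j = 0) (hη : η * z = 0 ∧ z * η = 0) :
    z ∈ Subalgebra.center F (DA F k s c) := by
  refine Subalgebra.mem_center_iff.2 fun b => ?_
  have hb : b ∈ Subalgebra.centralizer F {z} := by
    have hE1 : ε₁ ∈ Subalgebra.centralizer F {z} := by
      simpa [Subalgebra.mem_centralizer_iff] using h1.symm
    refine mem_subalgebra_of_generators_mem F k s c _ hE1 ?_ (fun j => ?_) ?_ b
    · rw [eq_sub_of_add_eq' (E1_add_E2 F k s c)]
      exact Subalgebra.sub_mem _ (Subalgebra.one_mem _) hE1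
    · simp [Subalgebra.mem_centralizer_iff, hδ j]
    · simp [Subalgebra.mem_centralizer_iff, hη]
  exact ((Subalgebra.mem_centralizer_iff F).1 hb z rfl).symm

theorem ABG_pow_mem_center (hk : 1 ≤ k) :
    ABG F k s c ^ k ∈ Subalgebra.center F (DA F k s c) := by
  have hABG : ABG F k s c = δ 0 * δ 2 * δ 1 := rfl
  have hk0 : k ≠ 0 := by omega
  refine mem_center_of_commute F c ?_
    (fun j => ⟨arr_mul_ABG_pow F c hk j, ABG_pow_mul_arr F c hk j⟩) ⟨?_, ?_⟩
  · have hl : ε₁ * ABG F k s c ^ k = ABG F k s c ^ k := by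
      rw [← mul_pow_sub_one hk0, hABG]
      simp only [← mul_assoc]
      rw [E1_mul_arr_zero]
    have hr : ABG F k s c ^ k * ε₁ = ABG F k s c ^ k := by
      rw [← pow_sub_one_mul hk0, hABG]
      simp only [mul_assoc]
      rw [arr_one_mul_E1]
    rw [hl, hr]
  · rw [← cyc_last_zero F c hk, Et_mul_cyc]
  · rw [← pow_sub_one_mul hk0, hABG, mul_assoc, mul_assoc _ (δ 1), arr_mul_Et, mul_zero, mul_zero]

theorem pow_Et_mem_center (hk : 1 ≤ k) (hs : 1 ≤ s) :
    η ^ s ∈ Subalgebra.center F (DA F k s c) := by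
  obtain ⟨t, rfl⟩ := Nat.exists_eq_add_of_le' hs
  have h0 : Et F k (t + 1) c ^ (t + 1 + 1) = 0 := pow_Et_eq_zero F c hk (t + 1) le_rfl
  refine mem_center_of_commute F c ?_
    (fun j => ⟨arr_mul_pow_Et F k _ c j t, pow_Et_mul_arr F k _ c j t⟩)
    ⟨by rw [← pow_succ', h0], by rw [← pow_succ, h0]⟩
  rw [pow_succ', ← mul_assoc, E1_mul_Et, zero_mul, ← pow_succ', pow_succ, mul_assoc, Et_mul_E1,
    mul_zero]

theorem cyc_last_mem_center (hk : 1 ≤ k) (hs : 1 ≤ s) (i : ZMod 3) :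
    π i (3 * k - 1) ∈ Subalgebra.center F (DA F k s c) := by
  rcases zmod_three_cases i with rfl | rfl | rfl
  · rw [cyc_last_zero F c hk]; exact ABG_pow_mem_center F c hk
  · rw [cyc_last_one F c hk]; exact ABG_pow_mem_center F c hk
  · rw [cyc_last_two F c hk]; exact pow_Et_mem_center F c hk hs

theorem coeff_eq_zero_of_arr_mul_eq_zero (hk : 1 ≤ k) (hs : 1 ≤ s)
    (hu : ABG F k s c ^ k ≠ 0) (hv : η ^ s ≠ 0) (a b : F) (p : ZMod 3 → ℕ → F) (d : ℕ → F)
    (h : ∀ j, δ j * (a • ε₁ + b • ε₂ + (∑ m ∈ Finset.range (3 * k), ∑ i, p i m • π i m +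
      ∑ l ∈ Finset.range s, d l • η ^ (l + 1))) = 0) :
    a = 0 ∧ b = 0 ∧ ∀ i m, m + 1 < 3 * k → p i m = 0 := by
  obtain ⟨N, hN⟩ : ∃ N, 3 * k = N + 1 := ⟨3 * k - 1, by omega⟩
  let t (j : ZMod 3) : ℕ → F := fun m =>
    Nat.casesOn m (if j = 2 then b else a) fun m => p (j - (m + 1 : ℕ)) m
  have hvert (j : ZMod 3) : δ j * (a • ε₁ + b • ε₂) = t j 0 • δ j := by
    change _ = (if j = 2 then b else a) • δ j
    rw [mul_add, mul_smul_comm, mul_smul_comm]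
    rcases zmod_three_cases j with rfl | rfl | rfl
    · rw [arr_zero_mul_E1, arr_zero_mul_E2, if_neg (by decide), smul_zero, add_zero]
    · rw [arr_one_mul_E1, arr_one_mul_E2, if_neg (by decide), smul_zero, add_zero]
    · rw [arr_two_mul_E1, arr_two_mul_E2, if_pos rfl, smul_zero, zero_add]
  have hloop (j : ZMod 3) : δ j * ∑ l ∈ Finset.range s, d l • η ^ (l + 1) = 0 := by
    rw [Finset.mul_sum]
    exact Finset.sum_eq_zero fun l _ => by rw [mul_smul_comm, arr_mul_pow_Et, smul_zero]
  have hmul (j : ZMod 3) : ∑ m ∈ Finset.range (3 * k), t j m • π (j - m) m +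
      (if j = 0 then (c * p 0 0) • ABG F k s c ^ k else 0) = 0 := by
    have hj := h j
    have hcorr : ∑ m ∈ Finset.range (N + 1),
        (if j = 0 ∧ m = 0 then (c * p 0 m) • ABG F k s c ^ k else 0) =
        if j = 0 then (c * p 0 0) • ABG F k s c ^ k else 0 := by
      rw [Finset.sum_eq_single_of_mem 0 (by simp) fun m _ hm => if_neg fun h => hm h.2]
      simp
    have htop (i : ZMod 3) : π i (N + 1) = 0 := cyc_eq_zero F c hk hs i _ hN.le
    rw [mul_add, hvert, mul_add, hloop, add_zero, Finset.mul_sum,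
      Finset.sum_congr rfl fun m _ => sum_arr_mul_cyc F c hk (fun i => p i m) j m,
      Finset.sum_add_distrib, hN, hcorr, Finset.sum_range_succ, htop, smul_zero, add_zero,
      ← add_assoc] at hj
    rw [hN, Finset.sum_range_succ', add_comm (∑ _ ∈ _, _)]
    simpa only [t, Nat.cast_zero, sub_zero, cyc_zero] using hj
  have hsolve (j : ZMod 3) (hj : ∑ m ∈ Finset.range (3 * k), t j m • π (j - m) m = 0) (m : ℕ)
      (hm : m < 3 * k) : t j m = 0 := by
    refine coeff_eq_zero_of_raising F (3 * k) (t j) (fun m => π (j - m) m)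
      (fun r => LinearMap.mulLeft F (cycAfter F k s c j r)) (fun r m hrm => ?_)
      (fun r m hrm => ?_) hj m hm
    · rw [LinearMap.mulLeft_apply, cycAfter_mul_cyc F c _ _ _ _ (sub_add_cancel _ _)]
      exact cyc_eq_zero F c hk hs _ _ hrm
    · rw [LinearMap.mulLeft_apply, cycAfter_mul_cyc F c _ _ _ _ (sub_add_cancel _ _),
        show m + r = 3 * k - 1 by omega]
      exact cyc_last_ne_zero F c hk hu hv _
  have ht1 := hsolve 1 (by simpa using hmul 1)
  have hp0 : p 0 0 = 0 := by simpa [t] using ht1 1 (by omega)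
  have ht (j : ZMod 3) : ∀ m < 3 * k, t j m = 0 := hsolve j (by simpa [hp0] using hmul j)
  refine ⟨ht 0 0 (by omega), ht 2 0 (by omega), fun i m hm => ?_⟩
  simpa [t] using ht (i + (m + 1 : ℕ)) (m + 1) hm

theorem coeff_eq_zero_of_Et_mul_eq_zero (hk : 1 ≤ k) (hv : η ^ s ≠ 0)
    (p : ZMod 3 → ℕ → F) (d : ℕ → F)
    (h : η * (∑ m ∈ Finset.range (3 * k), ∑ i, p i m • π i m +
      ∑ l ∈ Finset.range s, d l • η ^ (l + 1)) = 0) (l : ℕ) (hl : l + 1 < s) : d l = 0 := by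
  obtain ⟨N, rfl⟩ : ∃ N, s = N + 1 := ⟨s - 1, by omega⟩
  have hcyc : Et F k (N + 1) c * ∑ m ∈ Finset.range (3 * k), ∑ i, p i m • cyc F k (N + 1) c i m
      = 0 := by
    simp only [Finset.mul_sum, mul_smul_comm, Et_mul_cyc, smul_zero, Finset.sum_const_zero]
  have htop : Et F k (N + 1) c ^ (N + 1 + 1) = 0 := pow_Et_eq_zero F c hk _ le_rfl
  rw [mul_add, hcyc, zero_add, Finset.mul_sum, Finset.sum_range_succ] at h
  simp only [mul_smul_comm, ← pow_succ'] at h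
  rw [htop, smul_zero, add_zero] at h
  refine coeff_eq_zero_of_raising F N d (fun l => Et F k (N + 1) c ^ (l + 1 + 1))
    (fun r => LinearMap.mulLeft F (Et F k (N + 1) c ^ r)) (fun r m hrm => ?_)
    (fun r m hrm => ?_) h l (by omega)
  · rw [LinearMap.mulLeft_apply, ← pow_add, show r + (m + 1 + 1) = (m + r + 1) + 1 by ring]
    exact pow_Et_eq_zero F c hk _ (by omega)
  · rw [LinearMap.mulLeft_apply, ← pow_add, show r + (m + 1 + 1) = N + 1 by omega]
    exact hv

theorem mem_center_of_arrows_mul_eq_zero (hk : 1 ≤ k) (hs : 1 ≤ s)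
    (hu : ABG F k s c ^ k ≠ 0) (hv : η ^ s ≠ 0) {y : DA F k s c}
    (hδ : ∀ j, δ j * y = 0) (hη : η * y = 0) : y ∈ Subalgebra.center F (DA F k s c) := by
  obtain ⟨a, b, v, hv', rfl⟩ := exists_eq_add_mem_pathFil F c hk y
  obtain ⟨p, d, rfl⟩ := exists_coeff_of_mem_pathFil F c hk hs hv'
  obtain ⟨rfl, rfl, hp⟩ := coeff_eq_zero_of_arr_mul_eq_zero F c hk hs hu hv a b p d hδ
  rw [zero_smul, zero_smul, zero_add, zero_add] at hη ⊢
  have hd := coeff_eq_zero_of_Et_mul_eq_zero F c hk hv p d hη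
  refine Subalgebra.add_mem _ (Subalgebra.sum_mem _ fun m hm => Subalgebra.sum_mem _ fun i _ => ?_)
    (Subalgebra.sum_mem _ fun l hl => ?_)
  · rcases eq_or_ne (m + 1) (3 * k) with h | h
    · rw [show m = 3 * k - 1 by omega]
      exact Subalgebra.smul_mem _ (cyc_last_mem_center F c hk hs i) _
    · rw [hp i m (by have := Finset.mem_range.1 hm; omega), zero_smul]
      exact Subalgebra.zero_mem _
  · rcases eq_or_ne (l + 1) s with h | h
    · rw [h]
      exact Subalgebra.smul_mem _ (pow_Et_mem_center F c hk hs) _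
    · rw [hd l (by have := Finset.mem_range.1 hl; omega), zero_smul]
      exact Subalgebra.zero_mem _

theorem mul_eq_zero_of_mem_pathFil {z v : DA F k s c} (hδ : ∀ j, δ j * z = 0) (hη : η * z = 0)
    (hv : v ∈ pathFil F k s c 0) : v * z = 0 := by
  have : pathFil F k s c 0 ≤ LinearMap.ker (LinearMap.mulRight F z) := by
    refine Submodule.span_le.2 ?_
    rintro _ ⟨l, -, ⟨i, rfl⟩ | rfl⟩
    · change π i l * z = 0
      induction l with
      | zero => exact hδ i
      | succ l ih => rw [cyc_succ, mul_assoc, ih, mul_zero]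
    · change η ^ (l + 1) * z = 0
      rw [pow_succ, mul_assoc, hη, mul_zero]
  exact this hv

variable (s) in
/-- The left ideal of all elements annihilated by every arrow from the left. -/
def arrowAnnihilator (hk : 1 ≤ k) : Submodule (DA F k s c) (DA F k s c) where
  carrier := {z | (∀ j, δ j * z = 0) ∧ η * z = 0}
  zero_mem' := by simp
  add_mem' := fun ⟨h1, h2⟩ ⟨h1', h2'⟩ => by simp [mul_add, h1, h2, h1', h2']
  smul_mem' := fun x z ⟨hδ, hη⟩ => by
    obtain ⟨a, b, v, hv, rfl⟩ := exists_eq_add_mem_pathFil F c hk x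
    have hE1 (j : ZMod 3) : δ j * (ε₁ * z) = 0 := by
      rw [← mul_assoc]
      rcases zmod_three_cases j with rfl | rfl | rfl
      · rw [arr_zero_mul_E1, hδ]
      · rw [arr_one_mul_E1, hδ]
      · rw [arr_two_mul_E1, zero_mul]
    have hE2 : ε₂ * z = z - ε₁ * z := by
      rw [eq_sub_of_add_eq' (E1_add_E2 F k s c), sub_mul, one_mul]
    have hηE1 : η * (ε₁ * z) = 0 := by rw [← mul_assoc, Et_mul_E1, zero_mul]
    have hx : (a • ε₁ + b • ε₂ + v) * z = a • (ε₁ * z) + b • (z - ε₁ * z) := by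
      rw [add_mul, mul_eq_zero_of_mem_pathFil F c hδ hη hv, add_mul, smul_mul_assoc,
        smul_mul_assoc, hE2, add_zero]
    simp only [smul_eq_mul, Set.mem_ofPred_eq, hx, mul_add, mul_sub, mul_smul_comm, hE1, hδ, hη,
      hηE1, sub_zero, smul_zero, add_zero, implies_true, and_self]

theorem exists_ne_zero_mem_arrowAnnihilator (hk : 1 ≤ k) (hs : 1 ≤ s)
    (S : Submodule (DA F k s c) (DA F k s c)) {z : DA F k s c} (hz : z ∈ S) (hz0 : z ≠ 0) :
    ∃ y ∈ S, y ∈ arrowAnnihilator F s c hk ∧ y ≠ 0 := by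
  have hfil (n m : ℕ) (hnm : n + m = 3 * k + s) : ∀ z ∈ S, z ∈ pathFil F k s c m → z ≠ 0 →
      ∃ y ∈ S, y ∈ arrowAnnihilator F s c hk ∧ y ≠ 0 := by
    induction n generalizing m with
    | zero =>
      intro z _ hzm hz0
      rw [zero_add] at hnm
      exact absurd (eq_zero_of_mem_pathFil F c hk hs (hnm ▸ hzm)) hz0
    | succ n ih =>
      intro z hz hzm hz0
      by_cases hδ : ∀ j, δ j * z = 0
      · by_cases hη : η * z = 0
        · exact ⟨z, hz, ⟨hδ, hη⟩, hz0⟩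
        · exact ih (m + 1) (by omega) _ (S.smul_mem _ hz) (Et_mul_mem_pathFil F c hzm) hη
      · obtain ⟨j, hj⟩ := not_forall.1 hδ
        exact ih (m + 1) (by omega) _ (S.smul_mem _ hz) (arr_mul_mem_pathFil F c hk j hzm) hj
  have hmem (g : DA F k s c) (hg : g ∈ pathFil F k s c 0)
      (hgc : ∀ v ∈ pathFil F k s c 0, g * v ∈ pathFil F k s c 0)
      (h1 : g * ε₁ ∈ pathFil F k s c 0) : g * z ∈ pathFil F k s c 0 := by
    obtain ⟨a, b, v, hv, rfl⟩ := exists_eq_add_mem_pathFil F c hk z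
    rw [eq_sub_of_add_eq' (E1_add_E2 F k s c), mul_add, mul_add, mul_smul_comm, mul_smul_comm,
      mul_sub, mul_one]
    exact Submodule.add_mem _ (Submodule.add_mem _ (Submodule.smul_mem _ _ h1)
      (Submodule.smul_mem _ _ (Submodule.sub_mem _ hg h1))) (hgc v hv)
  have hδ0 (j : ZMod 3) : δ j ∈ pathFil F k s c 0 := cyc_mem_pathFil F c le_rfl j
  by_cases hδ : ∀ j, δ j * z = 0
  · by_cases hη : η * z = 0
    · exact ⟨z, hz, ⟨hδ, hη⟩, hz0⟩
    · refine hfil (3 * k + s) 0 rfl _ (S.smul_mem _ hz) (hmem η ?_ (fun v hv =>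
        pathFil_antitone F c (Nat.zero_le _) (Et_mul_mem_pathFil F c hv)) ?_) hη
      · simpa using pow_Et_mem_pathFil F c (le_refl 0)
      · rw [Et_mul_E1]; exact Submodule.zero_mem _
  · obtain ⟨j, hj⟩ := not_forall.1 hδ
    refine hfil (3 * k + s) 0 rfl _ (S.smul_mem _ hz) (hmem (δ j) (hδ0 j) (fun v hv =>
      pathFil_antitone F c (Nat.zero_le _) (arr_mul_mem_pathFil F c hk j hv)) ?_) hj
    rcases zmod_three_cases j with rfl | rfl | rfl
    · rw [arr_zero_mul_E1]; exact hδ0 0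
    · rw [arr_one_mul_E1]; exact hδ0 1
    · rw [arr_two_mul_E1]; exact Submodule.zero_mem _

theorem socle_le_arrowAnnihilator (hk : 1 ≤ k) (hs : 1 ≤ s) :
    socle (DA F k s c) ≤ arrowAnnihilator F s c hk := by
  refine sSup_le fun S (hS : IsAtom S) => ?_
  obtain ⟨z, hz, hz0⟩ := S.exists_mem_ne_zero_of_ne_bot hS.1
  obtain ⟨y, hy, hy', hy0⟩ := exists_ne_zero_mem_arrowAnnihilator F c hk hs S hz hz0
  rcases hS.le_iff.1 (inf_le_left : S ⊓ arrowAnnihilator F s c hk ≤ S) with h | h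
  · have : y ∈ (⊥ : Submodule (DA F k s c) (DA F k s c)) := h ▸ ⟨hy, hy'⟩
    exact absurd ((Submodule.mem_bot _).1 this) hy0
  · exact inf_eq_left.1 h

variable (k s) in
theorem exists_algHom_vertex (hk : 1 ≤ k) (hs : 1 ≤ s) {a b : F} (hadd : a + b = 1)
    (hmul : a * b = 0) : ∃ φ : DA F k s c →ₐ[F] F, φ ε₁ = a ∧ φ ε₂ = b ∧
      ∀ v ∈ pathFil F k s c 0, φ v = 0 := by
  have ha : a * a = a := by linear_combination a * hadd - hmul
  have hb : b * b = b := by linear_combination b * hadd - hmul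
  let f : Gen → F := fun t => match t with
    | .e1 => a
    | .e2 => b
    | _ => 0
  have hk0 : k ≠ 0 := by omega
  have hs0 : s ≠ 0 := by omega
  let φ : DA F k s c →ₐ[F] F := RingQuot.liftAlgHom F ⟨FreeAlgebra.lift F f, fun x y h => by
    cases h <;> simp [gen, f, ha, hb, hadd, hmul, mul_comm b a, hk0, hs0]⟩
  have hφ (t : Gen) : φ (mk F k s c (gen F t)) = f t :=
    (RingQuot.liftAlgHom_mkAlgHom_apply F _ _ _).trans (FreeAlgebra.lift_ι_apply f t)
  refine ⟨φ, hφ .e1, hφ .e2, ?_⟩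
  have hδ (j : ZMod 3) : φ (δ j) = 0 := by
    rcases zmod_three_cases j with rfl | rfl | rfl
    · exact hφ .a
    · exact hφ .g
    · exact hφ .b
  have : pathFil F k s c 0 ≤ LinearMap.ker φ.toLinearMap := by
    refine Submodule.span_le.2 ?_
    rintro _ ⟨l, -, ⟨i, rfl⟩ | rfl⟩
    · change φ (π i l) = 0
      cases l with
      | zero => exact hδ i
      | succ l => rw [cyc_succ, map_mul, hδ, zero_mul]
    · change φ (η ^ (l + 1)) = 0
      rw [map_pow, show φ η = 0 from hφ .h, zero_pow l.succ_ne_zero]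
  exact fun v hv => this hv

theorem map_eq_zero_of_pow_mem_Kspan {A : Type} [Ring A] [Algebra F A] (φ : A →ₐ[F] F) {x : A}
    {n : ℕ} (hx : x ^ n ∈ Kspan F A) : φ x = 0 := by
  have h : Kspan F A ≤ LinearMap.ker φ.toLinearMap := by
    refine Submodule.span_le.2 ?_
    rintro _ ⟨u, v, rfl⟩
    change φ (u * v - v * u) = 0
    rw [map_sub, map_mul, map_mul, mul_comm, sub_self]
  have h' : φ (x ^ n) = 0 := h hx
  rw [map_pow] at h'
  exact eq_zero_of_pow_eq_zero h'

theorem mem_pathFil_of_pow_mem_Kspan (hk : 1 ≤ k) (hs : 1 ≤ s) {x : DA F k s c} {n : ℕ}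
    (hx : x ^ n ∈ Kspan F (DA F k s c)) : x ∈ pathFil F k s c 0 := by
  obtain ⟨φ, hφ1, hφ2, hφ⟩ := exists_algHom_vertex F k s c hk hs (add_zero 1) (mul_zero 1)
  obtain ⟨χ, hχ1, hχ2, hχ⟩ := exists_algHom_vertex F k s c hk hs (zero_add 1) (zero_mul 1)
  have h1 := map_eq_zero_of_pow_mem_Kspan F φ hx
  have h2 := map_eq_zero_of_pow_mem_Kspan F χ hx
  obtain ⟨a, b, v, hv, rfl⟩ := exists_eq_add_mem_pathFil F c hk x
  have ha : a = 0 := by simpa [hφ1, hφ2, hφ v hv] using h1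
  have hb : b = 0 := by simpa [hχ1, hχ2, hχ v hv] using h2
  simpa [ha, hb] using hv

theorem ne_zero_of_mem_BB {ψ : DA F k s c →ₗ[F] F} (hψ : SoclePsi F k s c ψ) {p : DA F k s c}
    (hp : p ∈ BB F k s c) : p ≠ 0 := by
  rintro rfl
  have h := (hψ 0 hp).1 (Submodule.zero_mem _)
  rw [map_zero] at h
  exact zero_ne_one h

end Relations

/-- **Proposition (socle and generalized Reynolds ideals, dihedral type).**
For `k, s ≥ 1`, `c ∈ {0,1}` and every `n ≥ 0`, the socle of `A^{k,s}_c` is contained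
in the generalized Reynolds ideal `Tₙ(A^{k,s}_c)^⊥`; in particular the socle is
contained in the center `Z(A^{k,s}_c)`. -/
theorem dihedral_socle_subset_reynolds
    (F : Type) [Field F] [IsAlgClosed F] [CharP F 2]
    (k s : ℕ) (hk : 1 ≤ k) (hs : 1 ≤ s) (c : F) (hc : c = 0 ∨ c = 1)
    (ψ : DA F k s c →ₗ[F] F) (hψ : SoclePsi F k s c ψ) (n : ℕ) :
    ∀ y ∈ socle (DA F k s c),
      (∀ x : DA F k s c, x ^ 2 ^ n ∈ Kspan F (DA F k s c) → ψ (y * x) = 0) ∧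
      y ∈ Subalgebra.center F (DA F k s c) := by
  intro y hy
  have hu : ABG F k s c ^ k ≠ 0 :=
    ne_zero_of_mem_BB F c hψ (.inl (.inl (.inl (by simp [B11]))))
  have hv : Et F k s c ^ s ≠ 0 :=
    ne_zero_of_mem_BB F c hψ (.inr (.inr ⟨s, ⟨hs, le_rfl⟩, rfl⟩))
  obtain ⟨hδ, hη⟩ := socle_le_arrowAnnihilator F c hk hs hy
  have hyc : y ∈ Subalgebra.center F (DA F k s c) :=
    mem_center_of_arrows_mul_eq_zero F c hk hs hu hv hδ hη
  refine ⟨fun x hx => ?_, hyc⟩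
  rw [← Subalgebra.mem_center_iff.1 hyc x,
    mul_eq_zero_of_mem_pathFil F c hδ hη (mem_pathFil_of_pow_mem_Kspan F c hk hs hx), map_zero]

end DihedralPaper

end
end
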